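/- There is a constant C such that for all μ > 1, |N_Ω(μ) − |Ω|μ² + μ/2| ≤ C μ^{2/3 − 1/495}; that is, the lattice point remainder P_Ω(μ) = N_Ω(μ) − |Ω|μ² for the translated lattice ℤ² + (0,−1/4) satisfies P_Ω(μ) = −μ/2 + O(μ^{2/3 − 1/495}). -/

import Mathlib

open MeasureTheory Real Set
open scoped Pointwise

noncomputable def gfun (t : ℝ) : ℝ := (Real.sqrt (1 - t^2) - t * Real.arccos t) / Real.pi

def OmegaSet : Set (ℝ × ℝ) :=
  {p | -1 ≤ p.1 ∧ p.1 ≤ 1 ∧ max 0 (-p.1) ≤ p.2 ∧ p.2 ≤ gfun p.1}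

/-- The number of points of the lattice ℤ² + (0, -1/4) in the dilate μΩ. -/
noncomputable def NOmega (μ : ℝ) : ℕ :=
  Set.ncard {p : ℤ × ℤ | (((p.1 : ℝ)), ((p.2 : ℝ) - 1/4)) ∈ μ • OmegaSet}

/-- e(x) = exp(2 pi i x) -/
noncomputable def ee (x : ℝ) : ℂ := Complex.exp ((2 * Real.pi * x : ℝ) * Complex.I)

lemma ee_norm (x : ℝ) : ‖ee x‖ = 1 := by
  unfold ee; exact Complex.norm_exp_ofReal_mul_I _

lemma ee_add (x y : ℝ) : ee (x + y) = ee x * ee y := by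
  unfold ee; rw [← Complex.exp_add]; congr 1; push_cast; ring

lemma ee_int (k : ℤ) : ee k = 1 := by
  unfold ee
  rw [Complex.exp_eq_one_iff]
  exact ⟨k, by push_cast; ring⟩

lemma ee_zero : ee 0 = 1 := by simpa using ee_int 0

lemma ee_neg (x : ℝ) : ee (-x) = (starRingEnd ℂ) (ee x) := by
  unfold ee
  rw [← Complex.exp_conj]; congr 1
  rw [map_mul, Complex.conj_ofReal, Complex.conj_I]; push_cast; ring

lemma ee_sub_ee (x y : ℝ) : ‖ee x - ee y‖ ≤ 2 * Real.pi * |x - y| := by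
  have h : ee x - ee y = ee y * (ee (x - y) - 1) := by
    rw [mul_sub, ← ee_add]; simp
  rw [h, norm_mul, ee_norm, one_mul]
  unfold ee
  have := Real.norm_exp_I_mul_ofReal_sub_one_le (x := 2 * Real.pi * (x - y))
  rw [mul_comm Complex.I] at this
  refine this.trans ?_
  rw [Real.norm_eq_abs, abs_mul, abs_of_pos (by positivity)]

lemma ee_re (x : ℝ) : (ee x).re = Real.cos (2 * Real.pi * x) := by
  unfold ee; rw [Complex.exp_ofReal_mul_I_re]

lemma ee_eq (x : ℝ) : ee x = (Real.cos (2 * Real.pi * x) : ℂ) + (Real.sin (2 * Real.pi * x) : ℂ) * Complex.I := by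
  unfold ee; rw [Complex.exp_mul_I]; simp

/-- 1/(1-e(x)) = (1 + i cot(pi x))/2. -/
lemma ee_key (x : ℝ) (hx : Real.sin (Real.pi * x) ≠ 0) :
    ((1:ℂ)/2 + ((Real.cos (Real.pi * x) / Real.sin (Real.pi * x) : ℝ):ℂ)/2 * Complex.I) * (1 - ee x) = 1 := by
  rw [ee_eq]
  have h1 : Real.cos (2 * Real.pi * x) = 1 - 2 * Real.sin (Real.pi * x) ^ 2 := by
    rw [show 2 * Real.pi * x = 2 * (Real.pi * x) by ring, Real.cos_two_mul]
    have := Real.sin_sq_add_cos_sq (Real.pi * x); linarith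
  have h2 : Real.sin (2 * Real.pi * x) = 2 * Real.sin (Real.pi * x) * Real.cos (Real.pi * x) := by
    rw [show 2 * Real.pi * x = 2 * (Real.pi * x) by ring, Real.sin_two_mul]
  have h3 := Real.sin_sq_add_cos_sq (Real.pi * x)
  rw [h1, h2]
  set s := Real.sin (Real.pi * x)
  set c := Real.cos (Real.pi * x)
  have hs : (s:ℂ) ≠ 0 := by exact_mod_cast hx
  have h3' : (s:ℂ)^2 + (c:ℂ)^2 = 1 := by exact_mod_cast h3
  push_cast
  field_simp
  linear_combination (2 * (s:ℂ)) * h3' - (2 * c^2 * s : ℂ) * Complex.I_sq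

lemma cot_anti {x y : ℝ} (hx : 0 < x) (hxy : x ≤ y) (hy : y < 1) :
    Real.cos (Real.pi * y) / Real.sin (Real.pi * y) ≤ Real.cos (Real.pi * x) / Real.sin (Real.pi * x) := by
  have hp := Real.pi_pos
  have h1 : 0 < Real.sin (Real.pi * x) := Real.sin_pos_of_pos_of_lt_pi (by positivity) (by nlinarith)
  have h2 : 0 < Real.sin (Real.pi * y) := Real.sin_pos_of_pos_of_lt_pi (by nlinarith) (by nlinarith)
  rw [div_le_div_iff₀ h2 h1]
  have : 0 ≤ Real.sin (Real.pi * y - Real.pi * x) :=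
    Real.sin_nonneg_of_nonneg_of_le_pi (by nlinarith) (by nlinarith)
  rw [Real.sin_sub] at this
  linarith

lemma sin_lower {x θ : ℝ} (h0 : 0 < θ) (h1 : θ ≤ x) (h2 : x ≤ 1 - θ) : 2 * θ ≤ Real.sin (Real.pi * x) := by
  have hp := Real.pi_pos
  rcases le_total x (1/2) with h | h
  · have := Real.mul_le_sin (x := Real.pi * x) (by nlinarith) (by nlinarith)
    have e : 2 / Real.pi * (Real.pi * x) = 2 * x := by field_simp
    linarith
  · have := Real.mul_le_sin (x := Real.pi * (1 - x)) (by nlinarith) (by nlinarith)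
    have e : 2 / Real.pi * (Real.pi * (1 - x)) = 2 * (1 - x) := by field_simp
    rw [show Real.pi * (1 - x) = Real.pi - Real.pi * x by ring, Real.sin_pi_sub] at this
    rw [show Real.pi - Real.pi * x = Real.pi * (1 - x) by ring] at this
    linarith

lemma KL0 (f : ℕ → ℝ) (N : ℕ) (θ : ℝ) (h0 : 0 < θ) (hθ : θ ≤ 1/2)
    (h1 : ∀ n, n + 1 < N → θ ≤ f (n+1) - f n ∧ f (n+1) - f n ≤ 1 - θ)
    (h2 : ∀ n, n + 2 < N → f (n+1) - f n ≤ f (n+2) - f (n+1)) :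
    ‖∑ n ∈ Finset.range N, ee (f n)‖ ≤ 2 / θ := by
  have h1θ : 2 ≤ 1 / θ := by rw [le_div_iff₀ h0]; linarith
  rcases Nat.lt_or_ge N 2 with hN | hN
  · calc ‖∑ n ∈ Finset.range N, ee (f n)‖ ≤ ∑ n ∈ Finset.range N, ‖ee (f n)‖ := norm_sum_le _ _
      _ = N := by simp [ee_norm]
      _ ≤ 2 := by exact_mod_cast hN.le
      _ ≤ 2/θ := by rw [le_div_iff₀ h0]; linarith
  obtain ⟨M, rfl⟩ : ∃ M, N = M + 2 := ⟨N - 2, by omega⟩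
  set t : ℕ → ℝ := fun n => Real.cos (Real.pi * (f (n+1) - f n)) / Real.sin (Real.pi * (f (n+1) - f n)) with ht
  set c : ℕ → ℂ := fun n => (1:ℂ)/2 + (t n : ℂ)/2 * Complex.I with hc
  have hs : ∀ n, n ≤ M → 2 * θ ≤ Real.sin (Real.pi * (f (n+1) - f n)) := fun n hn =>
    sin_lower h0 (h1 n (by omega)).1 (h1 n (by omega)).2
  have hck : ∀ n, n ≤ M → ee (f n) = c n * (ee (f n) - ee (f (n+1))) := by
    intro n hn
    have k := ee_key (f (n+1) - f n) (by have := hs n hn; intro h; linarith)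
    have : ee (f (n+1)) = ee (f n) * ee (f (n+1) - f n) := by rw [← ee_add]; congr 1; ring
    rw [this]
    linear_combination (-ee (f n)) * k
  have htb : ∀ n, n ≤ M → |t n| ≤ 1 / (2*θ) := by
    intro n hn
    have hs' := hs n hn
    rw [ht]; simp only
    rw [abs_div, abs_of_pos (by linarith : 0 < Real.sin (Real.pi * (f (n+1) - f n)))]
    exact div_le_div₀ zero_le_one (Real.abs_cos_le_one _) (by positivity) hs'
  have hcb : ∀ n, n ≤ M → ‖c n‖ ≤ 1/2 + 1/(4*θ) := by
    intro n hn
    calc ‖c n‖ ≤ ‖(1:ℂ)/2‖ + ‖(t n : ℂ)/2 * Complex.I‖ := norm_add_le _ _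
      _ = 1/2 + |t n|/2 := by simp
      _ ≤ 1/2 + (1/(2*θ))/2 := by have := htb n hn; linarith
      _ = _ := by field_simp; ring
  have key : ∀ m, m ≤ M → ‖∑ n ∈ Finset.range m, c n * (ee (f n) - ee (f (n+1))) + c m * ee (f m)‖
      ≤ ‖c 0‖ + (t 0 - t m)/2 := by
    intro m
    induction m with
    | zero => intro _; simp [ee_norm]
    | succ m ih =>
      intro hm
      have e1 : ∑ n ∈ Finset.range (m+1), c n * (ee (f n) - ee (f (n+1))) + c (m+1) * ee (f (m+1))
          = (∑ n ∈ Finset.range m, c n * (ee (f n) - ee (f (n+1))) + c m * ee (f m)) + (c (m+1) - c m) * ee (f (m+1)) := by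
        rw [Finset.sum_range_succ]; ring
      rw [e1]
      have e2 : ‖(c (m+1) - c m) * ee (f (m+1))‖ = (t m - t (m+1))/2 := by
        rw [norm_mul, ee_norm, mul_one]
        have : c (m+1) - c m = (((t (m+1) - t m)/2 : ℝ):ℂ) * Complex.I := by simp only [hc]; push_cast; ring
        rw [this, norm_mul, Complex.norm_I, mul_one, Complex.norm_real, Real.norm_eq_abs, abs_of_nonpos]
        · ring
        · have := cot_anti (x := f (m+1) - f m) (y := f (m+2) - f (m+1)) (by have := (h1 m (by omega)).1; linarith)
            (h2 m (by omega)) (by have := (h1 (m+1) (by omega)).2; linarith)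
          simp only [ht]; linarith
      refine (norm_add_le _ _).trans ?_
      rw [e2]
      have := ih (by omega)
      linarith
  have k := key M le_rfl
  have e3 : ∑ n ∈ Finset.range (M+2), ee (f n) =
      (∑ n ∈ Finset.range M, c n * (ee (f n) - ee (f (n+1))) + c M * ee (f M)) - c M * ee (f (M+1)) + ee (f (M+1)) := by
    rw [Finset.sum_range_succ, Finset.sum_range_succ]
    rw [Finset.sum_congr rfl (fun n hn => hck n (by have := Finset.mem_range.1 hn; omega))]
    have := hck M le_rfl
    linear_combination this
  rw [e3]
  have b1 := hcb 0 (by omega)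
  have b2 := hcb M le_rfl
  have b3 := htb 0 (by omega)
  have b4 := htb M le_rfl
  have b5 := abs_le.1 b3
  have b6 := abs_le.1 b4
  have : ‖c M * ee (f (M+1))‖ ≤ 1/2 + 1/(4*θ) := by rw [norm_mul, ee_norm, mul_one]; exact b2
  have e4 : 1/(4*θ) = (1/θ)/4 := by field_simp
  have e5 : 1/(2*θ) = (1/θ)/2 := by field_simp
  have e6 : 2/θ = 2*(1/θ) := by ring
  rw [e4] at b1 this
  rw [e5] at b5 b6
  rw [e6]
  refine (norm_add_le _ _).trans ?_
  rw [ee_norm]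
  have := norm_sub_le (∑ n ∈ Finset.range M, c n * (ee (f n) - ee (f (n+1))) + c M * ee (f M)) (c M * ee (f (M+1)))
  linarith

lemma sum_Ico_int {E : Type*} [AddCommMonoid E] (F : ℤ → E) (a b : ℤ) :
    ∑ n ∈ Finset.Ico a b, F n = ∑ i ∈ Finset.range (b - a).toNat, F (a + i) := by
  symm
  refine Finset.sum_bij (fun i _ => a + (i:ℤ)) ?_ ?_ ?_ ?_
  · intro i hi; simp at hi ⊢; omega
  · intro i _ j _ h; simpa using h
  · intro n hn; simp at hn; exact ⟨(n - a).toNat, by simp; omega, by omega⟩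
  · intros; rfl

/-- Kusmin-Landau. -/
lemma KL (f : ℤ → ℝ) (a b k : ℤ) (θ : ℝ) (h0 : 0 < θ) (hθ : θ ≤ 1/2)
    (h1 : ∀ n, a ≤ n → n + 1 < b → k + θ ≤ f (n+1) - f n ∧ f (n+1) - f n ≤ k + 1 - θ)
    (h2 : ∀ n, a ≤ n → n + 2 < b → f (n+1) - f n ≤ f (n+2) - f (n+1)) :
    ‖∑ n ∈ Finset.Ico a b, ee (f n)‖ ≤ 2 / θ := by
  rw [sum_Ico_int]
  have := KL0 (fun i => f (a + i) - k * i) (b - a).toNat θ h0 hθ ?_ ?_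
  · refine le_trans (le_of_eq ?_) this
    congr 1
    refine Finset.sum_congr rfl fun i _ => ?_
    have : f (a + i) = (f (a+i) - k * i) + ((k * i : ℤ) : ℝ) := by push_cast; ring
    conv_lhs => rw [this, ee_add, ee_int, mul_one]
  · intro n hn
    have := h1 (a + n) (by omega) (by omega)
    simp only [Nat.cast_add, Nat.cast_one]
    rw [← add_assoc]
    push_cast
    constructor <;> linarith
  · intro n hn
    have := h2 (a + n) (by omega) (by omega)
    simp only [Nat.cast_add, Nat.cast_one, Nat.cast_ofNat]
    rw [← add_assoc, ← add_assoc]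
    push_cast
    linarith

lemma filter_Ico (d : ℤ → ℝ) (a b : ℤ) (hd : ∀ m n, a ≤ m → m ≤ n → n < b → d m ≤ d n) (S : Set ℝ)
    (hS : S.OrdConnected) [DecidablePred fun n => d n ∈ S] :
    ∃ a' b', a ≤ a' ∧ b' ≤ b ∧ (Finset.Ico a b).filter (fun n => d n ∈ S) = Finset.Ico a' b' := by
  set T := (Finset.Ico a b).filter (fun n => d n ∈ S) with hT
  rcases T.eq_empty_or_nonempty with h | h
  · exact ⟨a, min a b, le_rfl, min_le_right _ _, by rw [h]; simp⟩
  · refine ⟨T.min' h, T.max' h + 1, ?_, ?_, ?_⟩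
    · have := T.min'_mem h; simp only [T, Finset.mem_filter, Finset.mem_Ico] at this; exact this.1.1
    · have := Finset.mem_Ico.1 (Finset.mem_filter.1 (T.max'_mem h)).1; omega
    · ext n
      constructor
      · intro hn
        rw [Finset.mem_Ico]
        exact ⟨T.min'_le n hn, by have := T.le_max' n hn; omega⟩
      · intro hn
        rw [Finset.mem_Ico] at hn
        have m1 := T.min'_mem h
        have m2 := T.max'_mem h
        have m1' := Finset.mem_filter.1 m1
        have m2' := Finset.mem_filter.1 m2
        rw [Finset.mem_Ico] at m1' m2'
        rw [hT, Finset.mem_filter, Finset.mem_Ico]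
        refine ⟨⟨by omega, by omega⟩, hS.out m1'.2 m2'.2 ⟨hd _ _ m1'.1.1 hn.1 (by omega), hd _ _ (by omega) (by omega) m2'.1.2⟩⟩

lemma norm_sum_ee_le (f : ℤ → ℝ) (s : Finset ℤ) : ‖∑ n ∈ s, ee (f n)‖ ≤ s.card := by
  refine (norm_sum_le _ _).trans ?_
  simp [ee_norm]

lemma gap_lower (d : ℤ → ℝ) (a b : ℤ) (l : ℝ) (h : ∀ n, a ≤ n → n + 1 < b → l ≤ d (n+1) - d n) :
    ∀ (j : ℕ) (m : ℤ), a ≤ m → m + j < b → j * l ≤ d (m + j) - d m := by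
  intro j
  induction j with
  | zero => intro m _ _; simp
  | succ j ih =>
    intro m hm hb
    have h1 := ih m hm (by push_cast at hb; omega)
    have h2 := h (m + j) (by omega) (by push_cast at hb; omega)
    push_cast
    rw [← add_assoc]
    linarith

lemma SDT_count (d : ℤ → ℝ) (a b : ℤ) (l u w : ℝ) (hl : 0 < l) (hw : 0 ≤ w)
    (h : ∀ n, a ≤ n → n + 1 < b → l ≤ d (n+1) - d n) (S : Set ℝ) (hS : S.OrdConnected)
    (hSu : S ⊆ Set.Icc u (u + w)) [DecidablePred fun n => d n ∈ S] :
    (((Finset.Ico a b).filter (fun n => d n ∈ S)).card : ℝ) ≤ w / l + 1 := by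
  have hg := gap_lower d a b l h
  obtain ⟨a', b', h1, h2, h3⟩ := filter_Ico d a b (by
    intro m n hm hmn hn
    have := hg (n - m).toNat m hm (by omega)
    rw [show m + ((n - m).toNat : ℤ) = n by omega] at this
    have : (0:ℝ) ≤ (n - m).toNat * l := by positivity
    linarith) S hS
  rw [h3]
  rcases le_or_gt b' a' with hh | hh
  · rw [Finset.Ico_eq_empty (by omega)]; simp; positivity
  · have ma : a' ∈ (Finset.Ico a b).filter (fun n => d n ∈ S) := by rw [h3]; simp [hh]
    have mb : b' - 1 ∈ (Finset.Ico a b).filter (fun n => d n ∈ S) := by rw [h3]; simp; omega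
    have ma' := hSu (Finset.mem_filter.1 ma).2
    have mb' := hSu (Finset.mem_filter.1 mb).2
    have := hg (b' - 1 - a').toNat a' h1 (by omega)
    rw [show a' + ((b' - 1 - a').toNat : ℤ) = b' - 1 by omega] at this
    rw [Int.card_Ico]
    have e : (((b' - a').toNat : ℕ) : ℝ) = ((b' - 1 - a').toNat : ℕ) + 1 := by
      have : (b' - a').toNat = (b' - 1 - a').toNat + 1 := by omega
      rw [this]; push_cast; ring
    rw [e]
    have : ((b' - 1 - a').toNat : ℝ) ≤ w / l := by
      rw [le_div_iff₀ hl]; linarith [ma'.1, mb'.2]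
    linarith

lemma SDT0 (f : ℤ → ℝ) (a b : ℤ) (θ α K : ℝ) (hθ : 0 < θ) (hθ2 : θ ≤ 1/2) (hK : 0 ≤ K)
    (h1 : ∀ n, a ≤ n → n < b → α ≤ f (n+1) - f n ∧ f (n+1) - f n ≤ α + K)
    (h2 : ∀ n, a ≤ n → n + 1 < b → θ^2 ≤ (f (n+2) - f (n+1)) - (f (n+1) - f n)) :
    ‖∑ n ∈ Finset.Ico a b, ee (f n)‖ ≤ (K + 2) * (4 / θ + 2) := by
  classical
  set d : ℤ → ℝ := fun n => f (n+1) - f n with hd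
  have hgap : ∀ n, a ≤ n → n + 1 < b → θ^2 ≤ d (n+1) - d n := by
    intro n hn hb
    have := h2 n hn hb
    simp only [hd]; rw [show n + 1 + 1 = n + 2 by ring]; exact this
  have hmono : ∀ m n, a ≤ m → m ≤ n → n < b → d m ≤ d n := by
    intro m n hm hmn hn
    have := gap_lower d a b _ hgap (n - m).toNat m hm (by omega)
    rw [show m + ((n - m).toNat : ℤ) = n by omega] at this
    have : (0:ℝ) ≤ (n - m).toNat * θ^2 := by positivity
    linarith
  have hfib : ∀ k : ℤ, ‖∑ n ∈ (Finset.Ico a b).filter (fun n => ⌊d n⌋ = k), ee (f n)‖ ≤ 4 / θ + 2 := by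
    intro k
    set s := (Finset.Ico a b).filter (fun n => ⌊d n⌋ = k) with hs
    have c1 := SDT_count d a b (θ^2) k θ (by positivity) hθ.le hgap (Set.Ico (k:ℝ) (k+θ)) Set.ordConnected_Ico
      Set.Ico_subset_Icc_self
    have c2 := SDT_count d a b (θ^2) (k+1-θ) θ (by positivity) hθ.le hgap (Set.Ioo ((k:ℝ)+1-θ) (k+1)) Set.ordConnected_Ioo
      (by refine Set.Ioo_subset_Icc_self.trans ?_; rw [sub_add_cancel])
    have e : θ / θ^2 = 1/θ := by field_simp
    rw [e] at c1 c2
    have c3 : ‖∑ n ∈ (Finset.Ico a b).filter (fun n => d n ∈ Set.Icc ((k:ℝ)+θ) (k+1-θ)), ee (f n)‖ ≤ 2/θ := by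
      obtain ⟨a', b', g1, g2, g3⟩ := filter_Ico d a b hmono (Set.Icc ((k:ℝ)+θ) (k+1-θ)) Set.ordConnected_Icc
      rw [g3]
      apply KL f a' b' k θ hθ hθ2
      · intro n hn hb
        have : n ∈ (Finset.Ico a b).filter (fun n => d n ∈ Set.Icc ((k:ℝ)+θ) (k+1-θ)) := by
          rw [g3]; simp; omega
        exact (Finset.mem_filter.1 this).2
      · intro n hn hb
        have := h2 n (by omega) (by omega)
        nlinarith
    have hsplit : ∑ n ∈ s, ee (f n) = ∑ n ∈ (Finset.Ico a b).filter (fun n => d n ∈ Set.Ico (k:ℝ) (k+θ)), ee (f n)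
        + ∑ n ∈ (Finset.Ico a b).filter (fun n => d n ∈ Set.Icc ((k:ℝ)+θ) (k+1-θ)), ee (f n)
        + ∑ n ∈ (Finset.Ico a b).filter (fun n => d n ∈ Set.Ioo ((k:ℝ)+1-θ) (k+1)), ee (f n) := by
      rw [hs]
      simp only [Finset.sum_filter]
      rw [← Finset.sum_add_distrib, ← Finset.sum_add_distrib]
      refine Finset.sum_congr rfl fun n _ => ?_
      simp only [Set.mem_Ico, Set.mem_Icc, Set.mem_Ioo, Int.floor_eq_iff]
      generalize d n = x
      by_cases p1 : (k:ℝ) ≤ x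
      · by_cases p2 : x < k + 1
        · by_cases p3 : x < k + θ
          · have : ¬ ((k:ℝ) + θ ≤ x) := by linarith
            have : ¬ ((k:ℝ) + 1 - θ < x) := by linarith
            simp [*]
          · by_cases p4 : x ≤ k + 1 - θ
            · have : ¬ ((k:ℝ) + 1 - θ < x) := by linarith
              have : ((k:ℝ) + θ ≤ x) := by linarith
              simp [*]
            · have : ((k:ℝ) + 1 - θ < x) := by linarith
              simp [*]
        · have : ¬ x < k + θ := by linarith
          have : ¬ x ≤ k + 1 - θ := by linarith
          simp [*]
      · have : ¬ ((k:ℝ) + θ ≤ x) := by linarith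
        have : ¬ ((k:ℝ) + 1 - θ < x) := by linarith
        simp [*]
    rw [hsplit]
    have n1 := norm_sum_ee_le f ((Finset.Ico a b).filter (fun n => d n ∈ Set.Ico (k:ℝ) (k+θ)))
    have n2 := norm_sum_ee_le f ((Finset.Ico a b).filter (fun n => d n ∈ Set.Ioo ((k:ℝ)+1-θ) (k+1)))
    refine (norm_add₃_le).trans ?_
    have e4 : 4 / θ = 4 * (1/θ) := by ring
    have e2 : 2 / θ = 2 * (1/θ) := by ring
    rw [e2] at c3
    rw [e4]
    linarith
  rw [← Finset.sum_fiberwise_of_maps_to (s := Finset.Ico a b) (t := Finset.Icc ⌊α⌋ ⌊α + K⌋) (g := fun n => ⌊d n⌋)]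
  · refine (norm_sum_le _ _).trans ?_
    refine (Finset.sum_le_sum (fun k _ => hfib k)).trans ?_
    rw [Finset.sum_const, nsmul_eq_mul]
    refine mul_le_mul_of_nonneg_right ?_ (by positivity)
    rw [Int.card_Icc]
    have : ⌊α⌋ ≤ ⌊α + K⌋ := Int.floor_le_floor (by linarith)
    have e : (((⌊α + K⌋ + 1 - ⌊α⌋).toNat : ℕ) : ℝ) = ((⌊α + K⌋ + 1 - ⌊α⌋ : ℤ) : ℝ) := by
      exact_mod_cast Int.toNat_of_nonneg (by omega)
    rw [e]; push_cast
    have := Int.floor_le (α + K)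
    have := Int.lt_floor_add_one α
    linarith
  · intro n hn
    rw [Finset.mem_Ico] at hn
    have := h1 n hn.1 hn.2
    rw [Finset.mem_Icc]
    exact ⟨Int.floor_le_floor this.1, Int.floor_le_floor this.2⟩

/-- second derivative test -/
lemma SDT (f : ℤ → ℝ) (a b : ℤ) (l α K : ℝ) (hl : 0 < l) (hK : 0 ≤ K)
    (h1 : ∀ n, a ≤ n → n < b → α ≤ f (n+1) - f n ∧ f (n+1) - f n ≤ α + K)
    (h2 : ∀ n, a ≤ n → n + 1 < b → l ≤ (f (n+2) - f (n+1)) - (f (n+1) - f n)) :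
    ‖∑ n ∈ Finset.Ico a b, ee (f n)‖ ≤ 10 * (K + 2) * (1 / Real.sqrt l + 1) := by
  have hs : 0 < Real.sqrt l := Real.sqrt_pos.2 hl
  have hss : Real.sqrt l ^ 2 = l := Real.sq_sqrt hl.le
  have h3 : 0 < 1 / Real.sqrt l := by positivity
  rcases le_total (Real.sqrt l) (1/2) with h | h
  · refine (SDT0 f a b (Real.sqrt l) α K hs h hK h1 (by rw [hss]; exact h2)).trans ?_
    rw [show 4 / Real.sqrt l = 4 * (1 / Real.sqrt l) by ring]
    nlinarith
  · refine (SDT0 f a b (1/2) α K (by norm_num) le_rfl hK h1 (fun n hn hb => le_trans ?_ (h2 n hn hb))).trans ?_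
    · rw [← hss]; nlinarith
    · nlinarith

lemma corr_eq (f : ℤ → ℝ) (a b : ℤ) (R : ℕ) (z : ℤ → ℂ)
    (hz : ∀ n, z n = if n ∈ Finset.Ico a b then ee (f n) else 0) (r s : ℕ) (hr : r < R) (hsr : s ≤ r) :
    ∑ m ∈ Finset.Ico (a - R) b, z (m + r) * (starRingEnd ℂ) (z (m + s)) =
    ∑ n ∈ Finset.Ico a (b - ((r:ℤ) - s)), ee (f (n + ((r:ℤ) - s)) - f n) := by
  have h := Finset.sum_Ico_add' (fun n => ee (f (n + ((r:ℤ) - s)) - f n)) (a - s) (b - r) (s:ℤ)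
  rw [show a - (s:ℤ) + s = a by ring, show b - (r:ℤ) + s = b - ((r:ℤ) - s) by ring] at h
  rw [← h]
  rw [← Finset.sum_subset (s₁ := Finset.Ico (a - (s:ℤ)) (b - r))]
  · refine Finset.sum_congr rfl fun m hm => ?_
    rw [Finset.mem_Ico] at hm
    rw [hz, hz, if_pos (by rw [Finset.mem_Ico]; omega), if_pos (by rw [Finset.mem_Ico]; omega), ← ee_neg, ← ee_add]
    congr 1
    rw [show m + (s:ℤ) + ((r:ℤ) - s) = m + r by ring]; ring
  · intro m hm; rw [Finset.mem_Ico] at *; omega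
  · intro m hm hm'
    rw [Finset.mem_Ico] at *
    rw [hz, hz]
    by_cases h1 : m + (r:ℤ) ∈ Finset.Ico a b
    · by_cases h2 : m + (s:ℤ) ∈ Finset.Ico a b
      · rw [Finset.mem_Ico] at *; omega
      · rw [if_neg h2]; simp
    · rw [if_neg h1]; simp

/-- Weyl - van der Corput inequality -/
lemma vdC (f : ℤ → ℝ) (a b : ℤ) (R : ℕ) (M B : ℝ) (hR : 0 < R) (hM : (b - a : ℝ) ≤ M) (hRM : (R:ℝ) ≤ M) (hB : 0 ≤ B)
    (h : ∀ r : ℤ, 1 ≤ r → r < R → ‖∑ n ∈ Finset.Ico a (b - r), ee (f (n + r) - f n)‖ ≤ B) :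
    ‖∑ n ∈ Finset.Ico a b, ee (f n)‖ ^ 2 ≤ 2 * M * (M / R + B) := by
  have hR' : (0:ℝ) < R := by exact_mod_cast hR
  have hM0 : 0 < M := by linarith
  rcases lt_or_ge b a with hab | hab
  · rw [Finset.Ico_eq_empty (by omega)]; simp; positivity
  set z : ℤ → ℂ := fun n => if n ∈ Finset.Ico a b then ee (f n) else 0 with hz
  set S := ∑ n ∈ Finset.Ico a b, ee (f n) with hS
  set W := Finset.Ico (a - (R:ℤ)) b with hW
  have hsh : ∀ r ∈ Finset.range R, ∑ m ∈ W, z (m + (r:ℤ)) = S := by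
    intro r hr
    rw [Finset.mem_range] at hr
    have h := Finset.sum_Ico_add' (fun n => ee (f n)) (a - r) (b - r) (r:ℤ)
    rw [sub_add_cancel, sub_add_cancel] at h
    rw [hS, ← h]
    rw [← Finset.sum_subset (s₁ := Finset.Ico (a - (r:ℤ)) (b - r))]
    · refine Finset.sum_congr rfl fun m hm => ?_
      rw [Finset.mem_Ico] at hm
      simp only [hz]
      rw [if_pos (by rw [Finset.mem_Ico]; omega)]
    · intro m hm; rw [Finset.mem_Ico] at *; omega
    · intro m hm hm'
      rw [Finset.mem_Ico] at *
      simp only [hz]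
      rw [if_neg (by rw [Finset.mem_Ico]; omega)]
  have hcorr : ∀ r ∈ Finset.range R, ∀ s ∈ Finset.range R,
      ‖∑ m ∈ W, z (m + (r:ℤ)) * (starRingEnd ℂ) (z (m + (s:ℤ)))‖ ≤ (if r = s then M else 0) + B := by
    have main : ∀ r ∈ Finset.range R, ∀ s ∈ Finset.range R, s ≤ r →
      ‖∑ m ∈ W, z (m + (r:ℤ)) * (starRingEnd ℂ) (z (m + (s:ℤ)))‖ ≤ (if r = s then M else 0) + B := by
      intro r hr s hs hsr
      rw [Finset.mem_range] at hr
      rw [corr_eq f a b R z (fun n => rfl) r s hr hsr]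
      by_cases hrs : r = s
      · subst hrs
        simp only [sub_self, add_zero, sub_zero, ee_zero, if_true]
        simp only [Finset.sum_const, Int.card_Ico, nsmul_eq_mul, mul_one]
        rw [Complex.norm_natCast]
        have : (((b - a).toNat : ℕ) : ℝ) = ((b - a : ℤ) : ℝ) := by
          exact_mod_cast Int.toNat_of_nonneg (by omega)
        rw [this]; push_cast; linarith
      · rw [if_neg hrs, zero_add]
        exact h _ (by omega) (by omega)
    intro r hr s hs
    rcases le_total s r with h1 | h1
    · exact main r hr s hs h1
    · have := main s hs r hr h1
      rw [← Complex.norm_conj, map_sum]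
      simp only [map_mul, Complex.conj_conj]
      simp only [mul_comm _ (z _), eq_comm (a := r)] at this ⊢
      exact this
  have h1 : (R:ℂ) * S = ∑ m ∈ W, ∑ r ∈ Finset.range R, z (m + (r:ℤ)) := by
    rw [Finset.sum_comm, Finset.sum_congr rfl hsh]; simp
  have h2 : ((R:ℝ) * ‖S‖)^2 ≤ W.card * ∑ m ∈ W, ‖∑ r ∈ Finset.range R, z (m + (r:ℤ))‖^2 := by
    have e : (R:ℝ) * ‖S‖ = ‖∑ m ∈ W, ∑ r ∈ Finset.range R, z (m + (r:ℤ))‖ := by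
      rw [← h1, norm_mul, Complex.norm_natCast]
    rw [e]
    refine (pow_le_pow_left₀ (norm_nonneg _) (norm_sum_le _ _) 2).trans ?_
    exact sq_sum_le_card_mul_sum_sq
  have h3 : ∑ m ∈ W, ‖∑ r ∈ Finset.range R, z (m + (r:ℤ))‖^2 ≤ R * M + R^2 * B := by
    have e : ((∑ m ∈ W, ‖∑ r ∈ Finset.range R, z (m + (r:ℤ))‖^2 : ℝ) : ℂ) =
        ∑ r ∈ Finset.range R, ∑ s ∈ Finset.range R, ∑ m ∈ W, z (m + (r:ℤ)) * (starRingEnd ℂ) (z (m + (s:ℤ))) := by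
      push_cast
      have : ∀ m ∈ W, ((‖∑ r ∈ Finset.range R, z (m + (r:ℤ))‖ : ℂ))^2 =
          ∑ r ∈ Finset.range R, ∑ s ∈ Finset.range R, z (m + (r:ℤ)) * (starRingEnd ℂ) (z (m + (s:ℤ))) := by
        intro m _
        rw [← Complex.mul_conj', map_sum, Finset.sum_mul_sum]
      rw [Finset.sum_congr rfl this, Finset.sum_comm]
      refine Finset.sum_congr rfl fun r _ => ?_
      rw [Finset.sum_comm]
    have e2 : ∑ m ∈ W, ‖∑ r ∈ Finset.range R, z (m + (r:ℤ))‖^2 =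
        ‖((∑ m ∈ W, ‖∑ r ∈ Finset.range R, z (m + (r:ℤ))‖^2 : ℝ) : ℂ)‖ := by
      rw [Complex.norm_real, Real.norm_eq_abs, abs_of_nonneg]
      positivity
    rw [e2, e]
    refine (norm_sum_le _ _).trans ?_
    calc ∑ r ∈ Finset.range R, ‖∑ s ∈ Finset.range R, ∑ m ∈ W, z (m + (r:ℤ)) * (starRingEnd ℂ) (z (m + (s:ℤ)))‖
        ≤ ∑ r ∈ Finset.range R, ∑ s ∈ Finset.range R, ((if r = s then M else 0) + B) :=
          Finset.sum_le_sum fun r hr => (norm_sum_le _ _).trans (Finset.sum_le_sum fun s hs => hcorr r hr s hs)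
      _ = ∑ r ∈ Finset.range R, (M + R * B) := by
          refine Finset.sum_congr rfl fun r hr => ?_
          rw [Finset.sum_add_distrib, Finset.sum_ite_eq, if_pos hr]; simp
      _ = R * M + R^2 * B := by simp; ring
  have hc : (W.card : ℝ) ≤ 2 * M := by
    rw [hW, Int.card_Ico]
    have : (((b - (a - (R:ℤ))).toNat : ℕ) : ℝ) = ((b - (a - (R:ℤ)) : ℤ) : ℝ) := by
      exact_mod_cast Int.toNat_of_nonneg (by omega)
    rw [this]; push_cast; linarith
  have h4 : ((R:ℝ) * ‖S‖)^2 ≤ 2 * M * (R * M + R^2 * B) :=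
    h2.trans (mul_le_mul hc h3 (by positivity) (by positivity))
  have h5 : ‖S‖^2 = ((R:ℝ) * ‖S‖)^2 / R^2 := by field_simp
  rw [h5, div_le_iff₀ (by positivity)]
  refine h4.trans (le_of_eq ?_)
  field_simp

/-- Abel summation with monotone weights -/
lemma abel (w : ℕ → ℝ) (z : ℕ → ℂ) (N : ℕ) (B W : ℝ) (hw0 : ∀ n, n < N → 0 ≤ w n) (hw1 : ∀ n, n < N → w n ≤ W)
    (hw : ∀ n, n + 1 < N → w n ≤ w (n+1)) (hW : 0 ≤ W)
    (h : ∀ m, m ≤ N → ‖∑ n ∈ Finset.range m, z n‖ ≤ B) :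
    ‖∑ n ∈ Finset.range N, (w n : ℂ) * z n‖ ≤ 2 * W * B := by
  have hB : 0 ≤ B := by simpa using h 0 (by omega)
  rcases Nat.eq_zero_or_pos N with rfl | hN
  · simp; positivity
  obtain ⟨K, rfl⟩ : ∃ K, N = K + 1 := ⟨N - 1, by omega⟩
  have key : ∀ k, k ≤ K → ‖∑ n ∈ Finset.range (k+1), (w n : ℂ) * z n - (w k : ℂ) * ∑ n ∈ Finset.range (k+1), z n‖ ≤ (w k - w 0) * B := by
    intro k
    induction k with
    | zero => intro _; simp
    | succ k ih =>
      intro hk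
      have i := ih (by omega)
      have e : ∑ n ∈ Finset.range (k+1+1), (w n : ℂ) * z n - (w (k+1) : ℂ) * ∑ n ∈ Finset.range (k+1+1), z n
        = (∑ n ∈ Finset.range (k+1), (w n : ℂ) * z n - (w k : ℂ) * ∑ n ∈ Finset.range (k+1), z n)
          - ((w (k+1) - w k : ℝ):ℂ) * ∑ n ∈ Finset.range (k+1), z n := by
        rw [Finset.sum_range_succ _ (k+1), Finset.sum_range_succ _ (k+1)]; push_cast; ring
      rw [e]
      refine (norm_sub_le _ _).trans ?_
      rw [norm_mul, Complex.norm_real, Real.norm_eq_abs, abs_of_nonneg (by linarith [hw k (by omega)])]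
      have := mul_le_mul_of_nonneg_left (h (k+1) (by omega)) (by linarith [hw k (by omega)] : 0 ≤ w (k+1) - w k)
      linarith
  have k1 := key K le_rfl
  have k2 : ‖(w K : ℂ) * ∑ n ∈ Finset.range (K+1), z n‖ ≤ w K * B := by
    rw [norm_mul, Complex.norm_real, Real.norm_eq_abs, abs_of_nonneg (hw0 K (by omega))]
    exact mul_le_mul_of_nonneg_left (h _ le_rfl) (hw0 K (by omega))
  have k3 := norm_add_le (∑ n ∈ Finset.range (K+1), (w n : ℂ) * z n - (w K : ℂ) * ∑ n ∈ Finset.range (K+1), z n) ((w K : ℂ) * ∑ n ∈ Finset.range (K+1), z n)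
  rw [sub_add_cancel] at k3
  have a0 := hw0 0 (by omega)
  have a1 := hw1 K (by omega)
  nlinarith

lemma abel_int (w : ℤ → ℝ) (z : ℤ → ℂ) (a b : ℤ) (B W : ℝ) (hw0 : ∀ n, a ≤ n → n < b → 0 ≤ w n) (hw1 : ∀ n, a ≤ n → n < b → w n ≤ W)
    (hw : ∀ n, a ≤ n → n + 1 < b → w n ≤ w (n+1)) (hW : 0 ≤ W)
    (h : ∀ m, m ≤ b → ‖∑ n ∈ Finset.Ico a m, z n‖ ≤ B) :
    ‖∑ n ∈ Finset.Ico a b, (w n : ℂ) * z n‖ ≤ 2 * W * B := by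
  rw [sum_Ico_int]
  apply abel (fun i => w (a + i)) (fun i => z (a + i))
  · intro n hn; exact hw0 _ (by omega) (by omega)
  · intro n hn; exact hw1 _ (by omega) (by omega)
  · intro n hn; have := hw (a + n) (by omega) (by omega); push_cast; rwa [← add_assoc]
  · exact hW
  · intro m hm
    rcases lt_or_ge b a with hab | hab
    · have : m = 0 := by omega
      subst this
      simpa using (norm_nonneg _).trans (h (min a b) (min_le_right _ _))
    have := h (a + m) (by omega)
    rw [sum_Ico_int] at this
    simpa using this

lemma SDT_cos (A ω φ κ : ℝ) (a b : ℤ) (hA : 0 < A) (hω : 0 < ω) (hω1 : ω ≤ Real.pi) (hκ : 0 < κ)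
    (h : ∀ x : ℝ, (a:ℝ) ≤ x → x ≤ b → 0 ≤ ω * x + φ ∧ ω * x + φ ≤ Real.pi / 2 ∧ κ ≤ Real.cos (ω * x + φ)) :
    ‖∑ n ∈ Finset.Ico a b, ee (-(A * Real.cos (ω * n + φ)))‖ ≤ 10 * (A * ω + 2) * (1 / Real.sqrt (A * ω^2 * κ / 4) + 1) := by
  have hp := Real.pi_pos
  have hs1 : Real.sin (ω/2) ≤ ω/2 := Real.sin_le (by positivity)
  have hs2 : ω/Real.pi ≤ Real.sin (ω/2) := by
    have := Real.mul_le_sin (x := ω/2) (by positivity) (by linarith)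
    refine le_trans (le_of_eq ?_) this
    field_simp
  have hs0 : 0 ≤ Real.sin (ω/2) := le_trans (by positivity) hs2
  have hd : ∀ x : ℝ, -(A * Real.cos (ω * (x+1) + φ)) - -(A * Real.cos (ω * x + φ)) = 2 * A * Real.sin (ω/2) * Real.sin (ω * (x + 1/2) + φ) := by
    intro x
    have := Real.cos_sub_cos (ω * x + φ) (ω * (x+1) + φ)
    rw [show (ω * x + φ + (ω * (x+1) + φ))/2 = ω * (x + 1/2) + φ by ring, show (ω * x + φ - (ω * (x+1) + φ))/2 = -(ω/2) by ring, Real.sin_neg] at this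
    linear_combination A * this
  apply SDT (fun n => -(A * Real.cos (ω * n + φ))) a b (A * ω^2 * κ / 4) 0 (A * ω) (by positivity) (by positivity)
  · intro n hn hb
    have e := hd n
    simp only [Int.cast_add, Int.cast_one]
    rw [e]
    have hn' : (a:ℝ) ≤ n := by exact_mod_cast hn
    have hb' : (n:ℝ) + 1 ≤ b := by exact_mod_cast hb
    have h1 := h (n + 1/2) (by linarith) (by linarith)
    have h2 : 0 ≤ Real.sin (ω * (n + 1/2) + φ) := Real.sin_nonneg_of_nonneg_of_le_pi h1.1 (by linarith)
    have h3 := Real.sin_le_one (ω * (n + 1/2) + φ)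
    constructor
    · positivity
    · calc 2 * A * Real.sin (ω/2) * Real.sin (ω * (n + 1/2) + φ) ≤ 2 * A * Real.sin (ω/2) * 1 := by gcongr
        _ ≤ 2 * A * (ω/2) * 1 := by gcongr
        _ = 0 + A * ω := by ring
  · intro n hn hb
    have e := hd n
    have e' := hd (n+1)
    simp only [Int.cast_add, Int.cast_one, Int.cast_ofNat]
    rw [show (n:ℝ) + 2 = n + 1 + 1 by ring, e', e]
    have hn' : (a:ℝ) ≤ n := by exact_mod_cast hn
    have hb' : (n:ℝ) + 1 ≤ b := by exact_mod_cast hb.le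
    have h1 := h (n + 1) (by linarith) (by linarith)
    have := Real.sin_sub_sin (ω * ((n:ℝ) + 1 + 1/2) + φ) (ω * (n + 1/2) + φ)
    rw [show (ω * ((n:ℝ) + 1 + 1/2) + φ + (ω * (n + 1/2) + φ))/2 = ω * (n+1) + φ by ring, show (ω * ((n:ℝ) + 1 + 1/2) + φ - (ω * (n + 1/2) + φ))/2 = ω/2 by ring] at this
    have e2 : 2 * A * Real.sin (ω/2) * Real.sin (ω * ((n:ℝ) + 1 + 1/2) + φ) - 2 * A * Real.sin (ω/2) * Real.sin (ω * (n + 1/2) + φ)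
      = 4 * A * Real.sin (ω/2)^2 * Real.cos (ω * (n+1) + φ) := by linear_combination (2 * A * Real.sin (ω/2)) * this
    rw [e2]
    calc A * ω^2 * κ / 4 ≤ 4 * A * (ω/Real.pi)^2 * κ := by
          have : 4 * A * (ω/Real.pi)^2 * κ = A * ω^2 * κ * (4/Real.pi^2) := by field_simp
          rw [this, div_eq_mul_inv]
          gcongr
          rw [inv_eq_one_div, div_le_div_iff₀ (by positivity) (by positivity)]
          nlinarith [Real.pi_lt_four]
      _ ≤ 4 * A * Real.sin (ω/2)^2 * Real.cos (ω * (n+1) + φ) := by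
          have := h1.2.2
          gcongr

lemma diff3 (A ω : ℝ) (n r1 r2 r3 : ℝ) :
    ((A * Real.sin (ω * (n + r3 + r2 + r1)) - A * Real.sin (ω * (n + r3 + r2))) - (A * Real.sin (ω * (n + r3 + r1)) - A * Real.sin (ω * (n + r3))))
    - ((A * Real.sin (ω * (n + r2 + r1)) - A * Real.sin (ω * (n + r2))) - (A * Real.sin (ω * (n + r1)) - A * Real.sin (ω * n)))
    = -(8 * A * Real.sin (ω * r1 / 2) * Real.sin (ω * r2 / 2) * Real.sin (ω * r3 / 2) * Real.cos (ω * n + ω * (r1 + r2 + r3)/2)) := by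
  have d1 : ∀ x, Real.sin (ω * (x + r1)) - Real.sin (ω * x) = 2 * Real.sin (ω * r1/2) * Real.cos (ω * x + ω * r1/2) := by
    intro x
    rw [Real.sin_sub_sin]
    congr 2 <;> ring_nf
  have d2 : ∀ x, Real.cos (ω * (x + r2) + ω * r1/2) - Real.cos (ω * x + ω * r1/2) = - (2 * Real.sin (ω * r2/2) * Real.sin (ω * x + ω * (r1 + r2)/2)) := by
    intro x
    rw [Real.cos_sub_cos]
    rw [show (ω * (x + r2) + ω * r1/2 + (ω * x + ω * r1/2))/2 = ω * x + ω * (r1 + r2)/2 by ring,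
      show (ω * (x + r2) + ω * r1/2 - (ω * x + ω * r1/2))/2 = ω * r2/2 by ring]
    ring
  have d3 : Real.sin (ω * (n + r3) + ω * (r1 + r2)/2) - Real.sin (ω * n + ω * (r1 + r2)/2) = 2 * Real.sin (ω * r3/2) * Real.cos (ω * n + ω * (r1 + r2 + r3)/2) := by
    rw [Real.sin_sub_sin]
    rw [show (ω * (n + r3) + ω * (r1 + r2)/2 + (ω * n + ω * (r1 + r2)/2))/2 = ω * n + ω * (r1 + r2 + r3)/2 by ring,
      show (ω * (n + r3) + ω * (r1 + r2)/2 - (ω * n + ω * (r1 + r2)/2))/2 = ω * r3/2 by ring]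
  have a1 := d1 (n + r3 + r2)
  have a2 := d1 (n + r3)
  have a3 := d1 (n + r2)
  have a4 := d1 n
  have b1 := d2 (n + r3)
  have b2 := d2 n
  linear_combination A * (a1 - a2 - a3 + a4) + 2 * A * Real.sin (ω * r1/2) * (b1 - b2) - 4 * A * Real.sin (ω * r1/2) * Real.sin (ω * r2/2) * d3

lemma trig_final (Z h A ω s1 s2 s3 : ℝ) (hZ : 2 ≤ Z) (h1 : Z^51 ≤ h) (h2 : h ≤ Z^58) (hA : A = Z^160 * h / Real.pi)
    (hω : ω = Real.pi / h) (l1 : 1 / h ≤ s1) (l2 : 1 / h ≤ s2) (l3 : 1 / h ≤ s3)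
    (u1 : s1 ≤ 2 * Z^8 / h) (u2 : s2 ≤ 2 * Z^8 / h) (u3 : s3 ≤ 2 * Z^8 / h) :
    10 * (8 * A * s1 * s2 * s3 * ω + 2) * (1 / Real.sqrt (8 * A * s1 * s2 * s3 * ω^2 * (1/Z) / 4) + 1) ≤ 2800 * (h / Z^8) := by
  have hp := Real.pi_pos
  have hp3 := Real.pi_gt_three
  have hp4 := Real.pi_lt_d2
  have hZ0 : 0 < Z := by linarith
  have hZ1 : 1 ≤ Z := by linarith
  have hh : 0 < h := lt_of_lt_of_le (by positivity) h1
  set X := h / Z^8 with hX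
  have hX1 : 1 ≤ X := by
    rw [hX, le_div_iff₀ (by positivity), one_mul]
    exact le_trans (pow_le_pow_right₀ hZ1 (by norm_num)) h1
  have i1 : 0 < 1 / h := by positivity
  have p1 : 0 < s1 := by linarith
  have p2 : 0 < s2 := by linarith
  have p3 : 0 < s3 := by linarith
  have hA0 : 0 < A := by rw [hA]; positivity
  set A' := 8 * A * s1 * s2 * s3 with hA'
  have hA'0 : 0 < A' := by positivity
  have hω0 : 0 < ω := by rw [hω]; positivity
  have h4 : Z^204 ≤ h^4 := by
    calc Z^204 = (Z^51)^4 := by ring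
      _ ≤ h^4 := by gcongr
  have h22 : h^2 ≤ Z^116 := by
    calc h^2 ≤ (Z^58)^2 := by gcongr
      _ = Z^116 := by ring
  have up : A' ≤ 22 * Z^184 / h^2 := by
    calc A' ≤ 8 * A * (2 * Z^8 / h) * (2 * Z^8 / h) * (2 * Z^8 / h) := by rw [hA']; gcongr
      _ = 64 / Real.pi * Z^184 / h^2 := by rw [hA]; field_simp; ring
      _ ≤ 22 * Z^184 / h^2 := by
        gcongr; rw [div_le_iff₀ hp]; nlinarith
  have lo : 2 * Z^160 / h^2 ≤ A' := by
    calc 2 * Z^160 / h^2 ≤ 8 / Real.pi * Z^160 / h^2 := by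
          gcongr; rw [le_div_iff₀ hp]; nlinarith
      _ = 8 * A * (1/h) * (1/h) * (1/h) := by rw [hA]; field_simp
      _ ≤ A' := by rw [hA']; gcongr
  set l := A' * ω^2 * (1/Z) / 4 with hl
  have hl0 : 0 < l := by positivity
  have q1 : 1 / Real.sqrt l ≤ X := by
    rw [div_le_iff₀ (Real.sqrt_pos.2 hl0)]
    have : 1 ≤ X^2 * l := by
      calc (1:ℝ) ≤ h^2 * Real.pi^2 * (2 * Z^160) / (4 * Z^17 * h^4) := by
            rw [le_div_iff₀ (by positivity)]
            have e1 : Z^17 * h^2 ≤ Z^160 := by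
              calc Z^17 * h^2 ≤ Z^17 * Z^116 := by gcongr
                _ = Z^133 := by ring
                _ ≤ Z^160 := pow_le_pow_right₀ hZ1 (by norm_num)
            calc 1 * (4 * Z^17 * h^4) = h^2 * 2 * (2 * (Z^17 * h^2)) := by ring
              _ ≤ h^2 * Real.pi^2 * (2 * Z^160) := by
                gcongr; nlinarith
        _ = X^2 * ((2 * Z^160 / h^2) * ω^2 * (1/Z) / 4) := by rw [hX, hω]; field_simp
        _ ≤ X^2 * l := by rw [hl]; gcongr
    have h5 : 1 ≤ (X * Real.sqrt l)^2 := by rw [mul_pow, Real.sq_sqrt hl0.le]; exact this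
    have h6 : 0 ≤ X * Real.sqrt l := by positivity
    nlinarith
  have q2 : A' * ω ≤ 70 * X := by
    calc A' * ω ≤ (22 * Z^184 / h^2) * ω := by gcongr
      _ = 22 * Real.pi * Z^184 / h^3 := by rw [hω]; field_simp
      _ ≤ 70 * Z^184 / h^3 := by gcongr; linarith
      _ ≤ 70 * X := by
        rw [hX, div_le_iff₀ (by positivity)]
        have : Z^192 ≤ h^4 := le_trans (pow_le_pow_right₀ hZ1 (by norm_num)) h4
        calc 70 * Z^184 = 70 * Z^192 / Z^8 := by field_simp
          _ ≤ 70 * h^4 / Z^8 := by gcongr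
          _ = _ := by field_simp
  have q3 : A' * ω * (1 / Real.sqrt l) ≤ 10 * X := by
    rw [mul_one_div, div_le_iff₀ (Real.sqrt_pos.2 hl0)]
    have : (A' * ω)^2 ≤ (10 * X * Real.sqrt l)^2 := by
      rw [mul_pow _ (Real.sqrt l), Real.sq_sqrt hl0.le, hl]
      have : A' * (4 * Z) ≤ (10 * X)^2 := by
        calc A' * (4 * Z) ≤ (22 * Z^184 / h^2) * (4 * Z) := by gcongr
          _ = 88 * Z^201 / (h^2 * Z^16) := by field_simp; ring
          _ ≤ 88 * h^4 / (h^2 * Z^16) := by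
            gcongr; exact le_trans (pow_le_pow_right₀ hZ1 (by norm_num)) h4
          _ = 88 * X^2 := by rw [hX]; field_simp
          _ ≤ (10 * X)^2 := by nlinarith [sq_nonneg X]
      calc (A' * ω)^2 = A' * (4 * Z) * (A' * ω^2 * (1/Z) / 4) := by field_simp
        _ ≤ _ := by gcongr
    exact abs_le_of_sq_le_sq' this (by positivity) |>.2
  have e : 10 * (A' * ω + 2) * (1 / Real.sqrt l + 1) = 10 * (A' * ω * (1 / Real.sqrt l) + A' * ω + 2 * (1 / Real.sqrt l) + 2) := by ring
  rw [e]
  linarith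

lemma trig_sum (Z h : ℝ) (a b : ℤ) (hZ : 2 ≤ Z) (h1 : Z^51 ≤ h) (h2 : h ≤ Z^58) (ha : 0 ≤ a)
    (hb : (b:ℝ) ≤ h / 2 * (1 - 1/Z)) :
    ‖∑ n ∈ Finset.Ico a b, ee (Z^160 * h / Real.pi * Real.sin (Real.pi / h * n))‖ ≤ 6 * h / Z := by
  have hp := Real.pi_pos
  have hZ0 : 0 < Z := by linarith
  have hZ1 : 1 ≤ Z := by linarith
  have hh : 0 < h := lt_of_lt_of_le (by positivity) h1
  have hh1 : 1 ≤ h := le_trans (one_le_pow₀ hZ1) h1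
  set A := Z^160 * h / Real.pi with hA
  set ω := Real.pi / h with hω
  have hω0 : 0 < ω := by positivity
  have hA0 : 0 < A := by positivity
  have hω1 : ω ≤ Real.pi := by rw [hω]; exact div_le_self hp.le hh1
  set R : ℕ := ⌈Z^8⌉₊ with hR
  have hR1 : Z^8 ≤ R := Nat.le_ceil _
  have hR2 : (R:ℝ) < Z^8 + 1 := Nat.ceil_lt_add_one (by positivity)
  have hR0 : 0 < R := by
    have : (0:ℝ) < R := lt_of_lt_of_le (by positivity) hR1
    exact_mod_cast this
  have hRh : (R:ℝ) ≤ h := by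
    have : Z^8 * 2 ≤ h := by
      calc Z^8 * 2 ≤ Z^8 * Z := by gcongr
        _ = Z^9 := by ring
        _ ≤ Z^51 := pow_le_pow_right₀ hZ1 (by norm_num)
        _ ≤ h := h1
    have : 1 ≤ Z^8 := one_le_pow₀ hZ1
    linarith
  have hinvZ : 0 < 1 / Z := by positivity
  have hbh : (b:ℝ) ≤ h / 2 := by nlinarith
  have ha' : (0:ℝ) ≤ a := by exact_mod_cast ha
  have hX0 : 0 < h / Z^8 := by positivity
  have hMR : h / R ≤ h / Z^8 := by gcongr
  have hrs : ∀ r : ℤ, 1 ≤ r → r < R → 1 / h ≤ Real.sin (ω * r / 2) ∧ Real.sin (ω * r / 2) ≤ 2 * Z^8 / h := by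
    intro r hr1 hr2
    have hr1' : (1:ℝ) ≤ r := by exact_mod_cast hr1
    have hr2' : (r:ℝ) ≤ R - 1 := by
      have : r ≤ R - 1 := by omega
      exact_mod_cast this
    have hrZ : (r:ℝ) ≤ Z^8 := by linarith
    constructor
    · have := Real.mul_le_sin (x := ω * r / 2) (by positivity) (by
        rw [hω]
        have : Real.pi / h * r ≤ Real.pi := by
          rw [div_mul_eq_mul_div, div_le_iff₀ hh]; nlinarith
        linarith)
      refine le_trans ?_ this
      rw [hω]
      rw [show 2 / Real.pi * (Real.pi / h * r / 2) = r / h by field_simp]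
      gcongr
    · have := Real.sin_le (x := ω * r / 2) (by positivity)
      refine this.trans ?_
      rw [hω, show Real.pi / h * r / 2 = (Real.pi / 2 * r) / h by ring]
      gcongr
      linarith [Real.pi_lt_four]
  set f0 : ℤ → ℝ := fun n => A * Real.sin (ω * n) with hf0
  -- third difference
  have t3 : ∀ r1 r2 r3 : ℤ, 1 ≤ r1 → r1 < R → 1 ≤ r2 → r2 < R → 1 ≤ r3 → r3 < R →
      ‖∑ n ∈ Finset.Ico a (b - r1 - r2 - r3), ee (((f0 (n + r3 + r2 + r1) - f0 (n + r3 + r2)) - (f0 (n + r3 + r1) - f0 (n + r3)))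
        - ((f0 (n + r2 + r1) - f0 (n + r2)) - (f0 (n + r1) - f0 n)))‖ ≤ 2800 * (h / Z^8) := by
    intro r1 r2 r3 a1 b1 a2 b2 a3 b3
    have k1 := hrs r1 a1 b1
    have k2 := hrs r2 a2 b2
    have k3 := hrs r3 a3 b3
    have i1 : 0 < 1 / h := by positivity
    have fin := trig_final Z h A ω _ _ _ hZ h1 h2 hA hω k1.1 k2.1 k3.1 k1.2 k2.2 k3.2
    have A'0 : 0 < 8 * A * Real.sin (ω * r1 / 2) * Real.sin (ω * r2 / 2) * Real.sin (ω * r3 / 2) := by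
      have p1 : 0 < Real.sin (ω * r1 / 2) := by linarith
      have p2 : 0 < Real.sin (ω * r2 / 2) := by linarith
      have p3 : 0 < Real.sin (ω * r3 / 2) := by linarith
      positivity
    refine le_trans ?_ fin
    have c1 : (1:ℝ) ≤ r1 := by exact_mod_cast a1
    have c2 : (1:ℝ) ≤ r2 := by exact_mod_cast a2
    have c3 : (1:ℝ) ≤ r3 := by exact_mod_cast a3
    have := SDT_cos (8 * A * Real.sin (ω * r1 / 2) * Real.sin (ω * r2 / 2) * Real.sin (ω * r3 / 2)) ω (ω * (r1 + r2 + r3)/2) (1/Z)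
      a (b - r1 - r2 - r3) A'0 hω0 hω1 (by positivity) (by
        intro x hx1 hx2
        push_cast at hx2
        set y := x + ((r1:ℝ) + r2 + r3)/2 with hy
        have e : ω * x + ω * (r1 + r2 + r3)/2 = ω * y := by rw [hy]; ring
        have y0 : 0 ≤ y := by rw [hy]; linarith
        have y1 : y ≤ h / 2 * (1 - 1/Z) := by rw [hy]; linarith
        rw [e]
        have e2 : ω * y ≤ Real.pi / 2 - Real.pi / 2 * (1/Z) := by
          calc ω * y ≤ ω * (h / 2 * (1 - 1/Z)) := by gcongr
            _ = _ := by rw [hω]; field_simp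
        have e3 : 0 ≤ Real.pi / 2 * (1/Z) := by positivity
        refine ⟨by positivity, by linarith, ?_⟩
        rw [← Real.sin_pi_div_two_sub]
        have hy0 : 0 ≤ ω * y := by positivity
        have := Real.mul_le_sin (x := Real.pi / 2 - ω * y) (by linarith) (by linarith)
        refine le_trans ?_ this
        calc 1 / Z = 2 / Real.pi * (Real.pi / 2 * (1/Z)) := by field_simp
          _ ≤ _ := by gcongr; linarith)
    refine le_trans (le_of_eq ?_) this
    congr 1
    refine Finset.sum_congr rfl fun n _ => ?_
    congr 1
    simp only [hf0]
    push_cast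
    exact diff3 A ω n r1 r2 r3
  have len : ∀ c : ℤ, 0 ≤ c → ((b - c : ℤ) : ℝ) - a ≤ h := by
    intro c hc
    have : (0:ℝ) ≤ c := by exact_mod_cast hc
    push_cast; linarith
  have hsq : ∀ x y : ℝ, 0 ≤ y → x^2 ≤ y^2 → x ≤ y := fun x y hy hxy => (abs_le_of_sq_le_sq' hxy hy).2
  have t2 : ∀ r1 r2 : ℤ, 1 ≤ r1 → r1 < R → 1 ≤ r2 → r2 < R →
      ‖∑ n ∈ Finset.Ico a (b - r1 - r2), ee ((f0 (n + r2 + r1) - f0 (n + r2)) - (f0 (n + r1) - f0 n))‖ ≤ 75 * (h / Z^4) := by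
    intro r1 r2 a1 b1 a2 b2
    have := vdC (fun n => (f0 (n + r2 + r1) - f0 (n + r2)) - (f0 (n + r1) - f0 n)) a (b - r1 - r2) R h (2800 * (h / Z^8)) hR0
      (by have := len (r1 + r2) (by omega); push_cast at this ⊢; linarith) hRh (by positivity)
      (fun r hr1 hr2 => t3 r1 r2 r a1 b1 a2 b2 hr1 hr2)
    apply hsq _ _ (by positivity)
    refine this.trans ?_
    calc 2 * h * (h / R + 2800 * (h / Z^8)) ≤ 2 * h * (h / Z^8 + 2800 * (h / Z^8)) := by gcongr
      _ = 5602 * (h / Z^4)^2 := by field_simp; norm_num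
      _ ≤ _ := by nlinarith [sq_nonneg (h / Z^4)]
  have t1 : ∀ r1 : ℤ, 1 ≤ r1 → r1 < R →
      ‖∑ n ∈ Finset.Ico a (b - r1), ee (f0 (n + r1) - f0 n)‖ ≤ 13 * (h / Z^2) := by
    intro r1 a1 b1
    have := vdC (fun n => f0 (n + r1) - f0 n) a (b - r1) R h (75 * (h / Z^4)) hR0
      (by have := len r1 (by omega); push_cast at this ⊢; linarith) hRh (by positivity)
      (fun r hr1 hr2 => t2 r1 r a1 b1 hr1 hr2)
    apply hsq _ _ (by positivity)
    refine this.trans ?_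
    have z : h / Z^8 ≤ h / Z^4 := by gcongr <;> first | exact hZ1 | norm_num
    calc 2 * h * (h / R + 75 * (h / Z^4)) ≤ 2 * h * (h / Z^4 + 75 * (h / Z^4)) := mul_le_mul_of_nonneg_left (by linarith) (by linarith)
      _ = 152 * (h / Z^2)^2 := by field_simp; norm_num
      _ ≤ _ := by nlinarith [sq_nonneg (h / Z^2)]
  have := vdC f0 a b R h (13 * (h / Z^2)) hR0
      (by have := len 0 (by omega); push_cast at this ⊢; linarith) hRh (by positivity)
      (fun r hr1 hr2 => t1 r hr1 hr2)
  apply hsq _ _ (by positivity)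
  refine this.trans ?_
  have z : h / Z^8 ≤ h / Z^2 := by gcongr <;> first | exact hZ1 | norm_num
  calc 2 * h * (h / R + 13 * (h / Z^2)) ≤ 2 * h * (h / Z^2 + 13 * (h / Z^2)) := mul_le_mul_of_nonneg_left (by linarith) (by linarith)
    _ = 28 * (h / Z)^2 := by field_simp; norm_num
    _ ≤ _ := by rw [mul_div_assoc]; nlinarith [sq_nonneg (h / Z)]

lemma ee_cont : Continuous ee := by
  unfold ee; fun_prop

lemma sum_int_aux (q : ℝ → ℂ) (hq : Continuous q) (L : ℝ) (m : ℤ) (k : ℕ)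
    (h : ∀ x y : ℝ, (m:ℝ) ≤ x → x ≤ y → y ≤ m + k → y ≤ x + 1 → ‖q y - q x‖ ≤ L) :
    ‖∑ n ∈ Finset.Ico (m + 1) (m + k + 1), q (n:ℤ) - ∫ y in (m:ℝ)..(m + k), q y‖ ≤ L * k := by
  induction k with
  | zero => simp
  | succ k ih =>
    have ih' := ih (fun x y h1 h2 h3 h4 => h x y h1 h2 (by push_cast; linarith) h4)
    have e1 : Finset.Ico (m + 1) (m + ((k+1 : ℕ):ℤ) + 1) = insert (m + k + 1) (Finset.Ico (m + 1) (m + k + 1)) := by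
      ext x; simp only [Finset.mem_Ico, Finset.mem_insert]; push_cast; omega
    rw [e1, Finset.sum_insert (by simp)]
    have e2 : ∫ y in (m:ℝ)..(m + ((k+1:ℕ):ℝ)), q y = (∫ y in (m:ℝ)..(m + k), q y) + ∫ y in ((m:ℝ)+k)..(m + ((k+1:ℕ):ℝ)), q y := by
      rw [intervalIntegral.integral_add_adjacent_intervals] <;> exact hq.intervalIntegrable _ _
    have e3 : ‖q ((m + k + 1 : ℤ):ℝ) - ∫ y in ((m:ℝ)+k)..(m + ((k+1:ℕ):ℝ)), q y‖ ≤ L := by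
      have : q ((m + k + 1 : ℤ):ℝ) - ∫ y in ((m:ℝ)+k)..(m + ((k+1:ℕ):ℝ)), q y =
          ∫ y in ((m:ℝ)+k)..(m + ((k+1:ℕ):ℝ)), (q ((m + k + 1 : ℤ):ℝ) - q y) := by
        rw [intervalIntegral.integral_sub (by simp) (hq.intervalIntegrable _ _), intervalIntegral.integral_const]
        push_cast
        congr 1
        rw [show (m:ℝ) + (k + 1) - (m + k) = 1 by ring, one_smul]
      rw [this]
      refine (intervalIntegral.norm_integral_le_of_norm_le_const (C := L) ?_).trans ?_
      · intro x hx
        rw [Set.uIoc_of_le (by push_cast; linarith)] at hx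
        obtain ⟨h1, h2⟩ := hx
        have hk : (0:ℝ) ≤ k := by positivity
        push_cast at h2 ⊢
        exact h _ _ (by linarith) (by linarith) (by push_cast; linarith) (by linarith)
      · push_cast
        rw [show (m:ℝ) + (k + 1) - (m + k) = 1 by ring]; simp
    rw [e2]
    calc _ = ‖(∑ n ∈ Finset.Ico (m + 1) (m + k + 1), q (n:ℤ) - ∫ y in (m:ℝ)..(m + k), q y) +
          (q ((m + k + 1 : ℤ):ℝ) - ∫ y in ((m:ℝ)+k)..(m + ((k+1:ℕ):ℝ)), q y)‖ := by congr 1; ring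
      _ ≤ L * k + L := (norm_add_le _ _).trans (add_le_add ih' e3)
      _ = _ := by push_cast; ring

lemma sum_int (q : ℝ → ℂ) (hq : Continuous q) (L : ℝ) (a b : ℝ) (hab : a ≤ b) (hL : 0 ≤ L) (hn : ∀ x, ‖q x‖ ≤ 1)
    (h : ∀ x y : ℝ, a - 1 ≤ x → x ≤ y → y ≤ b → y ≤ x + 1 → ‖q y - q x‖ ≤ L) :
    ‖∑ n ∈ Finset.Ico (⌊a⌋ + 1) (⌊b⌋ + 1), q (n:ℤ) - ∫ y in a..b, q y‖ ≤ L * (b - a + 1) + 2 := by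
  obtain ⟨k, hk⟩ := Int.eq_ofNat_of_zero_le (sub_nonneg.2 (Int.floor_le_floor hab))
  have hb : ⌊b⌋ = ⌊a⌋ + k := by omega
  have hb' : (⌊b⌋:ℝ) = ⌊a⌋ + k := by exact_mod_cast hb
  have f1 := Int.floor_le a
  have f2 := Int.lt_floor_add_one a
  have f3 := Int.floor_le b
  have f4 := Int.lt_floor_add_one b
  have key := sum_int_aux q hq L ⌊a⌋ k (fun x y h1 h2 h3 h4 => h x y (by linarith) h2 (by linarith) h4)
  have n1 : ∀ u v : ℝ, u ≤ v → v ≤ u + 1 → ‖∫ y in u..v, q y‖ ≤ 1 := by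
    intro u v h1 h2
    refine (intervalIntegral.norm_integral_le_of_norm_le_const (C := 1) (fun x _ => hn x)).trans ?_
    rw [abs_of_nonneg (by linarith)]; linarith
  have s1 : ∫ y in a..b, q y = (∫ y in (⌊a⌋:ℝ)..(⌊a⌋ + k), q y) - (∫ y in (⌊a⌋:ℝ)..a, q y) + ∫ y in (⌊b⌋:ℝ)..b, q y := by
    rw [← hb']
    rw [intervalIntegral.integral_interval_sub_left (hq.intervalIntegrable _ _) (hq.intervalIntegrable _ _),
      intervalIntegral.integral_add_adjacent_intervals (hq.intervalIntegrable _ _) (hq.intervalIntegrable _ _)]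
  rw [hb, s1]
  calc _ = ‖(∑ n ∈ Finset.Ico (⌊a⌋ + 1) (⌊a⌋ + k + 1), q (n:ℤ) - ∫ y in (⌊a⌋:ℝ)..(⌊a⌋ + k), q y) + (∫ y in (⌊a⌋:ℝ)..a, q y)
        - ∫ y in (⌊b⌋:ℝ)..b, q y‖ := by congr 1; ring
    _ ≤ (L * k + 1) + 1 := (norm_sub_le _ _).trans (add_le_add ((norm_add_le _ _).trans (add_le_add key (n1 _ _ f1 (by linarith)))) (n1 _ _ f3 (by linarith)))
    _ ≤ _ := by
      have : (k:ℝ) ≤ b - a + 1 := by linarith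
      nlinarith

/-- truncated Fresnel integral -/
noncomputable def JJ (U : ℝ) : ℂ := ∫ u in (-U)..U, ee (u^2/2)

lemma gauss_sum (β x0 D : ℝ) (hβ : 0 < β) (hD : 0 ≤ D) :
    ‖∑ n ∈ Finset.Ico (⌊x0 - D⌋ + 1) (⌊x0 + D⌋ + 1), ee (β * ((n:ℤ) - x0)^2/2) - (1/√β : ℝ) * JJ (D * √β)‖
      ≤ 2 * π * β * (D + 1) * (2 * D + 1) + 2 := by
  have hs : 0 < √β := Real.sqrt_pos.2 hβ
  have := sum_int (fun y => ee (β * (y - x0)^2/2)) (ee_cont.comp (by fun_prop)) (2 * π * β * (D + 1)) (x0 - D) (x0 + D)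
    (by linarith) (by positivity) (fun x => (ee_norm _).le) (by
      intro x y h1 h2 h3 h4
      refine (ee_sub_ee _ _).trans ?_
      rw [show β * (y - x0)^2/2 - β * (x - x0)^2/2 = β * ((y - x) * (((y - x0) + (x - x0))/2)) by ring, abs_mul, abs_mul,
        abs_of_pos hβ, abs_of_nonneg (by linarith : 0 ≤ y - x), mul_assoc (2 * π)]
      gcongr
      calc (y - x) * |((y - x0) + (x - x0))/2| ≤ 1 * (D + 1) := by
            gcongr
            · linarith
            · rw [abs_le]; constructor <;> linarith
        _ = _ := one_mul _)
  rw [show x0 + D - (x0 - D) + 1 = 2 * D + 1 by ring] at this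
  have e : ∫ y in (x0 - D)..(x0 + D), ee (β * (y - x0)^2/2) = (1/√β : ℝ) * JJ (D * √β) := by
    have h1 : ∀ y, ee (β * (y - x0)^2/2) = (fun u => ee (u^2/2)) (√β * y - √β * x0) := by
      intro y
      simp only
      congr 1
      rw [← mul_sub, mul_pow, Real.sq_sqrt hβ.le]
    rw [intervalIntegral.integral_congr (fun y _ => h1 y)]
    rw [intervalIntegral.integral_comp_mul_sub (fun u => ee (u^2/2)) hs.ne' (√β * x0), JJ]
    rw [Complex.real_smul]
    congr 3
    · simp
    · ring
    · ring
  rw [e] at this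
  exact this

lemma JJ_bound (U : ℝ) (hU : 0 ≤ U) : ‖JJ U‖ ≤ 170 := by
  set β : ℝ := 1 / (1 + U)^4 with hβ
  have hβ0 : 0 < β := by positivity
  have hs : √β = 1 / (1+U)^2 := by
    rw [hβ, show 1 / (1+U)^4 = (1 / (1+U)^2)^2 by rw [div_pow, ← pow_mul]; norm_num, Real.sqrt_sq (by positivity)]
  set D : ℝ := U * (1+U)^2 with hD
  have hD0 : 0 ≤ D := by positivity
  have hDU : D * √β = U := by rw [hs, hD]; field_simp
  have g := gauss_sum β 0 D hβ0 hD0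
  rw [hDU] at g
  have f1 := Int.floor_le (0 - D)
  have f2 := Int.lt_floor_add_one (0 - D)
  have f3 := Int.floor_le (0 + D)
  have f4 := Int.lt_floor_add_one (0 + D)
  have s := SDT (fun n => β * ((n:ℤ) - 0)^2/2) (⌊0 - D⌋ + 1) (⌊0 + D⌋ + 1) β (β * (-D)) (β * (2 * D + 2)) hβ0 (by positivity) (by
      intro n h1 h2
      have h1' : ((⌊0 - D⌋:ℝ)) + 1 ≤ n := by exact_mod_cast h1
      have h2' : (n:ℝ) ≤ ⌊0 + D⌋ := by exact_mod_cast (by omega : n ≤ ⌊0+D⌋)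
      push_cast
      rw [show β * ((n:ℝ) + 1 - 0)^2/2 - β * ((n:ℝ) - 0)^2/2 = β * (n + 1/2) by ring, ← mul_add]
      constructor <;> apply mul_le_mul_of_nonneg_left _ hβ0.le <;> linarith) (by
      intro n h1 h2
      push_cast
      apply le_of_eq; ring)
  have t1 : β * D ≤ 1 := by
    rw [hβ, hD, one_div_mul_eq_div, div_le_one (by positivity)]
    nlinarith [mul_nonneg hU hU, pow_nonneg hU 3, pow_nonneg hU 4]
  have t0 : β ≤ 1 := by
    rw [hβ, div_le_one (by positivity)]
    exact one_le_pow₀ (by linarith)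
  have hsb : √β ≤ 1 := by rw [hs, div_le_one (by positivity)]; exact one_le_pow₀ (by linarith)
  have hs0 : 0 < √β := Real.sqrt_pos.2 hβ0
  have t2 : √β * (β * (D + 1) * (2 * D + 1)) ≤ 6 := by
    have : √β * (β * D * D) ≤ 1 := by
      rw [hs, hβ, hD, show 1 / (1+U)^2 * (1 / (1+U)^4 * (U * (1+U)^2) * (U * (1+U)^2)) = U^2/(1+U)^2 by field_simp,
        div_le_one (by positivity)]
      nlinarith
    nlinarith [mul_nonneg hβ0.le hD0]
  have main : ‖((1/√β : ℝ):ℂ) * JJ U‖ ≤ (2 * π * β * (D + 1) * (2 * D + 1) + 2) + 10 * (β * (2 * D + 2) + 2) * (1 / √β + 1) := by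
    rw [← norm_neg]
    rw [show -(((1/√β : ℝ):ℂ) * JJ U) = (∑ n ∈ Finset.Ico (⌊0 - D⌋ + 1) (⌊0 + D⌋ + 1), ee (β * ((n:ℤ) - 0)^2/2) - ((1/√β : ℝ):ℂ) * JJ U)
      - ∑ n ∈ Finset.Ico (⌊0 - D⌋ + 1) (⌊0 + D⌋ + 1), ee (β * ((n:ℤ) - 0)^2/2) by ring]
    exact (norm_sub_le _ _).trans (add_le_add g s)
  rw [norm_mul, Complex.norm_real, Real.norm_of_nonneg (by positivity)] at main
  have : ‖JJ U‖ = √β * (1 / √β * ‖JJ U‖) := by field_simp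
  rw [this]
  calc √β * (1 / √β * ‖JJ U‖) ≤ √β * ((2 * π * β * (D + 1) * (2 * D + 1) + 2) + 10 * (β * (2 * D + 2) + 2) * (1 / √β + 1)) := by gcongr
    _ = 2 * π * (√β * (β * (D + 1) * (2 * D + 1))) + 2 * √β + 10 * (2 * (β * D) + 2 * β + 2) * (1 + √β) := by field_simp
    _ ≤ 2 * 4 * 6 + 2 * 1 + 10 * (2 * 1 + 2 * 1 + 2) * (1 + 1) := by
      gcongr
      exact Real.pi_le_four
    _ ≤ _ := by norm_num

lemma sum_Ico_split (F : ℤ → ℂ) {a b c : ℤ} (h1 : a ≤ b) (h2 : b ≤ c) :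
    ∑ n ∈ Finset.Ico a b, F n + ∑ n ∈ Finset.Ico b c, F n = ∑ n ∈ Finset.Ico a c, F n := by
  rw [← Finset.Ico_union_Ico_eq_Ico h1 h2, Finset.sum_union (Finset.Ico_disjoint_Ico_consecutive a b c)]

lemma mvt_incr (p p' : ℝ → ℝ) (A B x : ℝ) (hp : ∀ x, A ≤ x → x ≤ B → HasDerivAt p (p' x) x) (h1 : A ≤ x) (h2 : x + 1 ≤ B) :
    ∃ ξ, x < ξ ∧ ξ < x + 1 ∧ p (x + 1) - p x = p' ξ := by
  obtain ⟨ξ, ⟨h3, h4⟩, h5⟩ := exists_hasDerivAt_eq_slope p p' (by linarith : x < x + 1)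
    (fun y hy => (hp y (by linarith [hy.1]) (by linarith [hy.2])).continuousAt.continuousWithinAt)
    (fun y hy => hp y (by linarith [hy.1]) (by linarith [hy.2]))
  exact ⟨ξ, h3, h4, by rw [h5]; simp⟩

lemma KL_mvt (p p' : ℝ → ℝ) (A B : ℝ) (k : ℤ) (θ : ℝ) (h0 : 0 < θ) (hθ : θ ≤ 1/2)
    (hp : ∀ x, A ≤ x → x ≤ B → HasDerivAt p (p' x) x)
    (hm : ∀ x y, A ≤ x → x ≤ y → y ≤ B → p' x ≤ p' y)
    (hb : ∀ x, A ≤ x → x ≤ B → k + θ ≤ p' x ∧ p' x ≤ k + 1 - θ) :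
    ‖∑ n ∈ Finset.Ico (⌊A⌋ + 1) (⌊B⌋ + 1), ee (p (n:ℤ))‖ ≤ 2 / θ := by
  have f1 := Int.floor_le A
  have f2 := Int.lt_floor_add_one A
  have f3 := Int.floor_le B
  have f4 := Int.lt_floor_add_one B
  apply KL (fun n => p (n:ℤ)) _ _ k θ h0 hθ
  · intro n h1 h2
    have h1' : (⌊A⌋:ℝ) + 1 ≤ n := by exact_mod_cast h1
    have h2' : (n:ℝ) + 1 ≤ ⌊B⌋ := by exact_mod_cast (by omega : n + 1 ≤ ⌊B⌋)
    obtain ⟨ξ, g1, g2, g3⟩ := mvt_incr p p' A B n hp (by linarith) (by linarith)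
    push_cast
    rw [g3]
    exact hb ξ (by linarith) (by linarith)
  · intro n h1 h2
    have h1' : (⌊A⌋:ℝ) + 1 ≤ n := by exact_mod_cast h1
    have h2' : (n:ℝ) + 2 ≤ ⌊B⌋ := by exact_mod_cast (by omega : n + 2 ≤ ⌊B⌋)
    obtain ⟨ξ, g1, g2, g3⟩ := mvt_incr p p' A B n hp (by linarith) (by linarith)
    obtain ⟨ξ', g1', g2', g3'⟩ := mvt_incr p p' A B (n+1) hp (by linarith) (by linarith)
    push_cast
    rw [show (n:ℝ) + 2 = n + 1 + 1 by ring, g3, g3']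
    exact hm ξ ξ' (by linarith) (by linarith) (by linarith)

lemma block (p p' : ℝ → ℝ) (A B x0 D β l Γ : ℝ) (hβ : 0 < β) (hD : 0 < D) (hl : 0 < l) (hΓ : 0 ≤ Γ)
    (hp : ∀ x, A ≤ x → x ≤ B → HasDerivAt p (p' x) x)
    (hm : ∀ x y, A ≤ x → x ≤ y → y ≤ B → l * (y - x) ≤ p' y - p' x)
    (hb : ∀ x, A ≤ x → x ≤ B → -(1/2) ≤ p' x ∧ p' x ≤ 1/2)
    (h0 : p' x0 = 0) (hA : A ≤ x0 - D) (hB : x0 + D ≤ B)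
    (ht : ∀ x, x0 - D ≤ x → x ≤ x0 + D → |p' x - β * (x - x0)| ≤ Γ * D^2) :
    ‖∑ n ∈ Finset.Ico (⌊A⌋ + 1) (⌊B⌋ + 1), ee (p (n:ℤ)) - ee (p x0) * ((1/√β : ℝ) * JJ (D * √β))‖
      ≤ 4 / (l * D) + 2 * π * (Γ * D^3) * (2 * D + 1) + (2 * π * β * (D + 1) * (2 * D + 1) + 2) := by
  have hmono : ∀ x y, A ≤ x → x ≤ y → y ≤ B → p' x ≤ p' y := fun x y h1 h2 h3 => by
    have := hm x y h1 h2 h3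
    have : 0 ≤ l * (y - x) := mul_nonneg hl.le (by linarith)
    linarith
  have hlD : 0 < l * D := by positivity
  have hθ : l * D ≤ 1/2 := by
    have := hm x0 (x0 + D) (by linarith) (by linarith) hB
    have h2 := (hb (x0 + D) (by linarith) hB).2
    rw [h0] at this
    simp at this
    linarith
  have R := KL_mvt p p' (x0 + D) B 0 (l * D) hlD hθ (fun x h1 h2 => hp x (by linarith) h2)
    (fun x y h1 h2 h3 => hmono x y (by linarith) h2 h3) (by
      intro x h1 h2
      have := hm x0 x (by linarith) (by linarith) h2
      have h3 := (hb x (by linarith) h2).2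
      have : l * D ≤ l * (x - x0) := by gcongr; linarith
      push_cast
      constructor <;> linarith)
  have L := KL_mvt p p' A (x0 - D) (-1) (l * D) hlD hθ (fun x h1 h2 => hp x h1 (by linarith))
    (fun x y h1 h2 h3 => hmono x y h1 h2 (by linarith)) (by
      intro x h1 h2
      have := hm x x0 h1 (by linarith) (by linarith)
      have h3 := (hb x h1 (by linarith)).1
      have : l * D ≤ l * (x0 - x) := by gcongr; linarith
      push_cast
      constructor <;> linarith)
  have f1 := Int.floor_le (x0 - D)
  have f2 := Int.lt_floor_add_one (x0 - D)
  have f3 := Int.floor_le (x0 + D)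
  have f4 := Int.lt_floor_add_one (x0 + D)
  have fAD : ⌊A⌋ ≤ ⌊x0 - D⌋ := Int.floor_le_floor hA
  have fDD : ⌊x0 - D⌋ ≤ ⌊x0 + D⌋ := Int.floor_le_floor (by linarith)
  have fDB : ⌊x0 + D⌋ ≤ ⌊B⌋ := Int.floor_le_floor hB
  have tay : ∀ x, x0 - D ≤ x → x ≤ x0 + D → |p x - (p x0 + β * (x - x0)^2/2)| ≤ Γ * D^3 := by
    intro x h1 h2
    have := Convex.norm_image_sub_le_of_norm_hasDerivWithin_le (f := fun x => p x - β * (x - x0)^2/2)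
      (f' := fun x => p' x - β * (x - x0)) (s := Set.Icc (x0 - D) (x0 + D)) (x := x0) (y := x) (C := Γ * D^2)
      (by
        intro y hy
        apply HasDerivAt.hasDerivWithinAt
        have d1 := hp y (by linarith [hy.1]) (by linarith [hy.2])
        have d2 : HasDerivAt (fun y => β * (y - x0)^2/2) (β * (y - x0)) y := by
          have := ((((hasDerivAt_id y).sub_const x0).pow 2).const_mul β).div_const 2
          refine this.congr_deriv ?_
          simp only [id]; push_cast; ring
        exact d1.sub d2)
      (by intro y hy; exact ht y hy.1 hy.2) (convex_Icc _ _) ⟨by linarith, by linarith⟩ ⟨h1, h2⟩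
    simp only [sub_self, Real.norm_eq_abs] at this
    rw [show p x - (p x0 + β * (x - x0)^2/2) = p x - β * (x - x0)^2/2 - (p x0 - β * 0^2/2) by ring]
    refine this.trans ?_
    have : |x - x0| ≤ D := by rw [abs_le]; constructor <;> linarith
    calc Γ * D^2 * |x - x0| ≤ Γ * D^2 * D := by gcongr
      _ = _ := by ring
  have M1 : ‖∑ n ∈ Finset.Ico (⌊x0 - D⌋ + 1) (⌊x0 + D⌋ + 1), ee (p (n:ℤ)) -
      ee (p x0) * ∑ n ∈ Finset.Ico (⌊x0 - D⌋ + 1) (⌊x0 + D⌋ + 1), ee (β * ((n:ℤ) - x0)^2/2)‖ ≤ 2 * π * (Γ * D^3) * (2 * D + 1) := by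
    rw [Finset.mul_sum, ← Finset.sum_sub_distrib]
    refine (norm_sum_le_of_le (f := fun n : ℤ => ee (p n) - ee (p x0) * ee (β * (n - x0)^2/2)) _ (n := fun _ => 2 * π * (Γ * D^3)) ?_).trans ?_
    · intro n hn
      rw [Finset.mem_Ico] at hn
      have h1' : (⌊x0 - D⌋:ℝ) + 1 ≤ n := by exact_mod_cast hn.1
      have h2' : (n:ℝ) ≤ ⌊x0 + D⌋ := by exact_mod_cast (by omega : n ≤ ⌊x0 + D⌋)
      rw [← ee_add]
      refine (ee_sub_ee _ _).trans ?_
      gcongr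
      exact tay n (by linarith) (by linarith)
    · rw [Finset.sum_const, nsmul_eq_mul, mul_comm, Int.card_Ico]
      gcongr
      have : (((⌊x0 + D⌋ + 1 - (⌊x0 - D⌋ + 1)).toNat : ℤ):ℝ) = ((⌊x0 + D⌋ - ⌊x0 - D⌋ : ℤ) : ℝ) := by
        rw [Int.toNat_of_nonneg (by omega)]; congr 1; ring
      have e : (((⌊x0 + D⌋ + 1 - (⌊x0 - D⌋ + 1)).toNat : ℕ):ℝ) = ((⌊x0 + D⌋ - ⌊x0 - D⌋ : ℤ) : ℝ) := by
        rw [← this]; norm_cast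
      rw [e]; push_cast; linarith
  have G := gauss_sum β x0 D hβ hD.le
  have sp : ∑ n ∈ Finset.Ico (⌊A⌋ + 1) (⌊B⌋ + 1), ee (p (n:ℤ)) = ∑ n ∈ Finset.Ico (⌊A⌋ + 1) (⌊x0 - D⌋ + 1), ee (p (n:ℤ))
      + ∑ n ∈ Finset.Ico (⌊x0 - D⌋ + 1) (⌊x0 + D⌋ + 1), ee (p (n:ℤ)) + ∑ n ∈ Finset.Ico (⌊x0 + D⌋ + 1) (⌊B⌋ + 1), ee (p (n:ℤ)) := by
    rw [sum_Ico_split _ (by omega) (by omega), sum_Ico_split _ (by omega) (by omega)]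
  rw [sp]
  set S2 := ∑ n ∈ Finset.Ico (⌊x0 - D⌋ + 1) (⌊x0 + D⌋ + 1), ee (p (n:ℤ))
  set S1 := ∑ n ∈ Finset.Ico (⌊A⌋ + 1) (⌊x0 - D⌋ + 1), ee (p (n:ℤ))
  set S3 := ∑ n ∈ Finset.Ico (⌊x0 + D⌋ + 1) (⌊B⌋ + 1), ee (p (n:ℤ))
  set Q := ∑ n ∈ Finset.Ico (⌊x0 - D⌋ + 1) (⌊x0 + D⌋ + 1), ee (β * ((n:ℤ) - x0)^2/2)
  set Y := ((1/√β : ℝ):ℂ) * JJ (D * √β)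
  have G' : ‖ee (p x0) * (Q - Y)‖ ≤ 2 * π * β * (D + 1) * (2 * D + 1) + 2 := by
    rw [norm_mul, ee_norm, one_mul]; exact G
  calc ‖S1 + S2 + S3 - ee (p x0) * Y‖ = ‖S1 + S3 + (S2 - ee (p x0) * Q) + ee (p x0) * (Q - Y)‖ := by congr 1; ring
    _ ≤ 2 / (l * D) + 2 / (l * D) + 2 * π * (Γ * D^3) * (2 * D + 1) + (2 * π * β * (D + 1) * (2 * D + 1) + 2) :=
      (norm_add_le _ _).trans (add_le_add ((norm_add_le _ _).trans (add_le_add ((norm_add_le _ _).trans (add_le_add L R)) M1)) G')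
    _ = _ := by ring

lemma gfun_deriv (t : ℝ) (h1 : -1 < t) (h2 : t < 1) : HasDerivAt gfun (-Real.arccos t / π) t := by
  have p : 0 < 1 - t^2 := by nlinarith
  have d0 : HasDerivAt (fun t : ℝ => 1 - t^2) (-(2 * t)) t := by
    have := ((hasDerivAt_id t).pow 2).const_sub 1
    refine this.congr_deriv ?_
    simp
  have d1 := d0.sqrt p.ne'
  have d2 := (hasDerivAt_id t).mul (Real.hasDerivAt_arccos (by linarith : t ≠ -1) (by linarith : t ≠ 1))
  have := (d1.sub d2).div_const π
  refine this.congr_deriv ?_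
  have : √(1 - t^2) ≠ 0 := (Real.sqrt_pos.2 p).ne'
  simp only [id]
  field_simp
  ring

lemma arccos_gap (s t : ℝ) (hs : -1 ≤ s) (hst : s ≤ t) (ht : t ≤ 1) : t - s ≤ Real.arccos s - Real.arccos t := by
  have h := Real.arccos_le_arccos hst
  have e1 := Real.cos_arccos hs (by linarith)
  have e2 := Real.cos_arccos (by linarith) ht
  have := Real.abs_cos_sub_cos_le (Real.arccos t) (Real.arccos s)
  rw [e1, e2, abs_of_nonneg (by linarith), abs_sub_comm, abs_of_nonneg (by linarith)] at this
  exact this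

lemma cos_taylor (x y : ℝ) : |Real.cos y - Real.cos x + Real.sin x * (y - x)| ≤ (y - x)^2 := by
  have := Convex.norm_image_sub_le_of_norm_hasDerivWithin_le (f := fun z => Real.cos z + Real.sin x * z)
      (f' := fun z => -Real.sin z + Real.sin x * 1) (s := Set.uIcc x y) (x := x) (y := y) (C := |y - x|)
      (by
        intro z hz
        exact ((Real.hasDerivAt_cos z).add ((hasDerivAt_id z).const_mul _)).hasDerivWithinAt)
      (by
        intro z hz
        rw [Real.norm_eq_abs, show -Real.sin z + Real.sin x * 1 = Real.sin x - Real.sin z by ring, abs_sub_comm]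
        refine (Real.abs_sin_sub_sin_le _ _).trans ?_
        exact Set.abs_sub_left_of_mem_uIcc hz) (convex_uIcc _ _) Set.left_mem_uIcc Set.right_mem_uIcc
  simp only [Real.norm_eq_abs] at this
  rw [show Real.cos y - Real.cos x + Real.sin x * (y - x) = Real.cos y + Real.sin x * y - (Real.cos x + Real.sin x * x) by ring]
  refine this.trans ?_
  rw [← abs_mul, ← sq, abs_of_nonneg (sq_nonneg _)]

lemma cos_gap (κ x y : ℝ) (hxy : x ≤ y) (h : ∀ z, x ≤ z → z ≤ y → κ ≤ Real.sin z) : κ * (y - x) ≤ Real.cos x - Real.cos y := by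
  rcases hxy.eq_or_lt with rfl | hlt
  · simp
  obtain ⟨ξ, ⟨h3, h4⟩, h5⟩ := exists_hasDerivAt_eq_slope Real.cos (fun x => -Real.sin x) hlt
    Real.continuous_cos.continuousOn (fun y hy => Real.hasDerivAt_cos y)
  have := h ξ h3.le h4.le
  rw [eq_div_iff (by linarith)] at h5
  nlinarith

set_option maxHeartbeats 800000 in
lemma block_app0 (μ h κ D : ℝ) (ν : ℤ) (hμ : 0 < μ) (hh : 0 < h) (hκ : 0 < κ) (hD : 0 < D) (hν1 : 1 ≤ ν) (hν2 : (ν:ℝ) + 1/2 ≤ h/2)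
    (hsin : ∀ z, π / h * (ν - 1/2) ≤ z → z ≤ π / h * (ν + 1/2) → κ ≤ Real.sin z) (hDb : D ≤ μ * κ * (π / h / 2)) (β l Γ : ℝ)
    (hβ : β = h / (π * μ * Real.sin (π / h * ν))) (hl : l = h / (π * μ)) (hΓ : Γ = h / (π * κ^3 * μ^2)) :
    ‖∑ n ∈ Finset.Ico (⌊μ * Real.cos (π / h * (ν + 1/2))⌋ + 1) (⌊μ * Real.cos (π / h * (ν - 1/2))⌋ + 1), ee (h * (μ * gfun ((n:ℤ) / μ)))
      - ee (μ * h / π * Real.sin (π / h * ν)) * ((1/√β : ℝ) * JJ (D * √β))‖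
      ≤ 4 / (l * D) + 2 * π * (Γ * D^3) * (2 * D + 1) + (2 * π * β * (D + 1) * (2 * D + 1) + 2) := by
  have hπ := Real.pi_pos
  set ω := π / h with hω
  have hω0 : 0 < ω := by positivity
  set τ1 := ω * (ν - 1/2) with hτ1
  set τ0 := ω * ν with hτ0
  set τ2 := ω * (ν + 1/2) with hτ2
  have hν1' : (1:ℝ) ≤ ν := by exact_mod_cast hν1
  have τ1p : 0 < τ1 := mul_pos hω0 (by linarith)
  have τ10 : τ1 = τ0 - ω/2 := by rw [hτ1, hτ0]; ring
  have τ20 : τ2 = τ0 + ω/2 := by rw [hτ2, hτ0]; ring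
  have τ2π : τ2 ≤ π/2 := by
    calc τ2 ≤ ω * (h/2) := by rw [hτ2]; gcongr
      _ = π/2 := by rw [hω]; field_simp
  have s0 : κ ≤ Real.sin τ0 := hsin τ0 (by linarith) (by linarith)
  have s0p : 0 < Real.sin τ0 := by linarith
  have hβ0 : 0 < β := by rw [hβ]; positivity
  have hl0 : 0 < l := by rw [hl]; positivity
  have hΓ0 : 0 < Γ := by rw [hΓ]; positivity
  -- points of the block
  have pt : ∀ x, μ * Real.cos τ2 ≤ x → x ≤ μ * Real.cos τ1 → 0 ≤ x / μ ∧ x / μ < 1 ∧ τ1 ≤ Real.arccos (x/μ) ∧ Real.arccos (x/μ) ≤ τ2 ∧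
      x = μ * Real.cos (Real.arccos (x/μ)) := by
    intro x h1 h2
    have c1 : Real.cos τ2 ≤ x/μ := by rw [le_div_iff₀ hμ]; linarith
    have c2 : x/μ ≤ Real.cos τ1 := by rw [div_le_iff₀ hμ]; linarith
    have c3 : 0 ≤ Real.cos τ2 := Real.cos_nonneg_of_neg_pi_div_two_le_of_le (by linarith) τ2π
    have c4 : Real.cos τ1 < 1 := by
      rw [← Real.cos_zero]
      exact Real.cos_lt_cos_of_nonneg_of_le_pi le_rfl (by linarith) τ1p
    have a1 := Real.arccos_le_arccos c1
    have a2 := Real.arccos_le_arccos c2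
    rw [Real.arccos_cos (by linarith) (by linarith)] at a1 a2
    refine ⟨by linarith, by linarith, a2, a1, ?_⟩
    rw [Real.cos_arccos (by linarith) (by linarith)]
    field_simp
  have x0e : Real.arccos (μ * Real.cos τ0 / μ) = τ0 := by
    rw [mul_div_cancel_left₀ _ hμ.ne', Real.arccos_cos (by linarith) (by linarith)]
  have bA : μ * Real.cos τ2 ≤ μ * Real.cos τ0 - D := by
    have := cos_gap κ τ0 τ2 (by linarith) (fun z h1 h2 => hsin z (by linarith) h2)
    have k : μ * (κ * (τ2 - τ0)) ≤ μ * (Real.cos τ0 - Real.cos τ2) := by gcongr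
    have e : μ * (κ * (τ2 - τ0)) = μ * κ * (ω / 2) := by rw [τ20]; ring
    rw [mul_sub] at k
    linarith
  have bB : μ * Real.cos τ0 + D ≤ μ * Real.cos τ1 := by
    have := cos_gap κ τ1 τ0 (by linarith) (fun z h1 h2 => hsin z h1 (by linarith))
    have k : μ * (κ * (τ0 - τ1)) ≤ μ * (Real.cos τ1 - Real.cos τ0) := by gcongr
    have e : μ * (κ * (τ0 - τ1)) = μ * κ * (ω / 2) := by rw [τ10]; ring
    rw [mul_sub] at k
    linarith
  have key := block (fun x => h * (μ * gfun (x / μ)) + ν * x) (fun x => -(h / π) * Real.arccos (x/μ) + ν) (μ * Real.cos τ2) (μ * Real.cos τ1)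
    (μ * Real.cos τ0) D β l Γ hβ0 hD hl0 hΓ0.le (by
      intro x h1 h2
      obtain ⟨p1, p2, -⟩ := pt x h1 h2
      have d := (gfun_deriv (x/μ) (by linarith) p2).comp x ((hasDerivAt_id x).div_const μ)
      have := ((d.const_mul μ).const_mul h).add ((hasDerivAt_id x).const_mul (ν:ℝ))
      refine this.congr_deriv ?_
      field_simp) (by
      intro x y h1 h2 h3
      obtain ⟨p1, p2, -⟩ := pt x h1 (by linarith)
      obtain ⟨q1, q2, -⟩ := pt y (by linarith) h3
      have := arccos_gap (x/μ) (y/μ) (by linarith) (by gcongr) (by linarith)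
      have : h/π * (y/μ - x/μ) ≤ h/π * (Real.arccos (x/μ) - Real.arccos (y/μ)) := by gcongr
      have e : l * (y - x) = h/π * (y/μ - x/μ) := by rw [hl]; field_simp
      rw [e]; linarith) (by
      intro x h1 h2
      obtain ⟨-, -, p3, p4, -⟩ := pt x h1 h2
      have e1 : h/π * τ1 ≤ h/π * Real.arccos (x/μ) := by gcongr
      have e2 : h/π * Real.arccos (x/μ) ≤ h/π * τ2 := by gcongr
      have e3 : h/π * τ1 = ν - 1/2 := by rw [hτ1, hω]; field_simp
      have e4 : h/π * τ2 = ν + 1/2 := by rw [hτ2, hω]; field_simp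
      constructor <;> linarith) (by
      simp only [x0e]
      rw [hτ0, hω]; field_simp; ring) bA bB (by
      intro x h1 h2
      have b1 : μ * Real.cos τ2 ≤ x := by linarith
      have b2 : x ≤ μ * Real.cos τ1 := by linarith
      obtain ⟨-, -, p3, p4, p5⟩ := pt x b1 b2
      set τ := Real.arccos (x/μ) with hτ
      have ct := cos_taylor τ0 τ
      have gap : κ * |τ - τ0| ≤ |Real.cos τ - Real.cos τ0| := by
        rcases le_total τ τ0 with hle | hle
        · have := cos_gap κ τ τ0 hle (fun z h1 h2 => hsin z (by linarith) (by linarith))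
          rw [abs_of_nonpos (by linarith : τ - τ0 ≤ 0)]
          refine le_trans ?_ (le_abs_self _); linarith
        · have := cos_gap κ τ0 τ hle (fun z h1 h2 => hsin z (by linarith) (by linarith))
          rw [abs_of_nonneg (by linarith : 0 ≤ τ - τ0)]
          refine le_trans ?_ (neg_le_abs _); linarith
      have gap2 : |τ - τ0| ≤ D / (μ * κ) := by
        rw [le_div_iff₀ (by positivity)]
        have : μ * |Real.cos τ - Real.cos τ0| ≤ D := by
          have : μ * |Real.cos τ - Real.cos τ0| = |μ * (Real.cos τ - Real.cos τ0)| := by rw [abs_mul, abs_of_pos hμ]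
          rw [this, mul_sub, ← p5, abs_le]; constructor <;> linarith
        calc |τ - τ0| * (μ * κ) = μ * (κ * |τ - τ0|) := by ring
          _ ≤ μ * |Real.cos τ - Real.cos τ0| := by gcongr
          _ ≤ D := this
      have e : -(h/π) * τ + ν - β * (x - μ * Real.cos τ0) = -(h / (π * Real.sin τ0)) * (Real.cos τ - Real.cos τ0 + Real.sin τ0 * (τ - τ0)) := by
        have : (ν:ℝ) = h/π * τ0 := by rw [hτ0, hω]; field_simp
        rw [this, p5, hβ]
        field_simp
        ring
      rw [e, abs_mul, abs_neg, abs_of_pos (by positivity)]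
      calc h / (π * Real.sin τ0) * |Real.cos τ - Real.cos τ0 + Real.sin τ0 * (τ - τ0)| ≤ h / (π * κ) * (D / (μ * κ))^2 := by
            gcongr
            refine ct.trans ?_
            rw [← sq_abs]; gcongr
        _ = Γ * D^2 := by rw [hΓ]; field_simp)
  refine le_trans (le_of_eq ?_) key
  have e1 : ∀ n : ℤ, ee (h * (μ * gfun ((n:ℝ) / μ)) + ν * n) = ee (h * (μ * gfun ((n:ℤ) / μ))) := by
    intro n
    rw [ee_add]
    have : ee ((ν:ℝ) * n) = 1 := by
      have := ee_int (ν * n); push_cast at this; exact this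
    rw [this, mul_one]
  have e2 : h * (μ * gfun (μ * Real.cos τ0 / μ)) + ν * (μ * Real.cos τ0) = μ * h / π * Real.sin τ0 := by
    unfold gfun
    rw [x0e, mul_div_cancel_left₀ _ hμ.ne']
    rw [show 1 - Real.cos τ0 ^2 = Real.sin τ0 ^2 by rw [← Real.sin_sq_add_cos_sq τ0]; ring, Real.sqrt_sq s0p.le]
    have : (ν:ℝ) = h/π * τ0 := by rw [hτ0, hω]; field_simp
    rw [this]; field_simp; ring
  simp only [e1, e2]

lemma gfun_cont : Continuous gfun := by
  unfold gfun
  exact ((by fun_prop : Continuous fun t : ℝ => √(1 - t^2)).sub (continuous_id.mul Real.continuous_arccos)).div_const _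

lemma fh_deriv (μ h x : ℝ) (hμ : 0 < μ) (h1 : 0 < x) (h2 : x < μ) :
    HasDerivAt (fun x => h * (μ * gfun (x / μ))) (-(h / π) * Real.arccos (x/μ)) x := by
  have p1 : 0 < x / μ := by positivity
  have p2 : x / μ < 1 := by rw [div_lt_one hμ]; exact h2
  have d := (gfun_deriv (x/μ) (by linarith) p2).comp x ((hasDerivAt_id x).div_const μ)
  refine ((d.const_mul μ).const_mul h).congr_deriv ?_
  field_simp

lemma SDT_phi (μ h : ℝ) (a b : ℤ) (α K : ℝ) (hμ : 0 < μ) (hh : 0 < h) (ha : 0 ≤ a) (hb : (b:ℝ) ≤ μ + 1) (hK : 0 ≤ K)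
    (hr : ∀ x : ℝ, (a:ℝ) < x → x < b - 1 → α ≤ -(h/π) * Real.arccos (x/μ) ∧ -(h/π) * Real.arccos (x/μ) ≤ α + K) :
    ‖∑ n ∈ Finset.Ico a b, ee (h * (μ * gfun ((n:ℤ) / μ)))‖ ≤ 10 * (K + 2) * (√(π * μ / h) + 1) + 1 := by
  have hπ := Real.pi_pos
  have ha' : (0:ℝ) ≤ a := by exact_mod_cast ha
  rcases le_or_gt b a with hab | hab
  · rw [Finset.Ico_eq_empty (by omega)]
    simp only [Finset.sum_empty, norm_zero]
    positivity
  have contf : Continuous (fun x => h * (μ * gfun (x / μ))) := by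
    have := gfun_cont
    fun_prop
  set f : ℝ → ℝ := fun x => h * (μ * gfun (x / μ)) with hf
  have s := SDT (fun n => f n) a (b - 1) (h / (π * μ)) α K (by positivity) hK (by
    intro n h1 h2
    have h1' : (a:ℝ) ≤ n := by exact_mod_cast h1
    have h2' : (n:ℝ) + 1 ≤ b - 1 := by exact_mod_cast (by omega : n + 1 ≤ b - 1)
    obtain ⟨ξ, ⟨h3, h4⟩, h5⟩ := exists_hasDerivAt_eq_slope f (fun x => -(h / π) * Real.arccos (x/μ)) (by linarith : (n:ℝ) < n + 1)
      contf.continuousOn (fun y hy => fh_deriv μ h y hμ (by linarith [hy.1]) (by linarith [hy.2]))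
    push_cast
    rw [show f (n + 1) - f n = -(h / π) * Real.arccos (ξ/μ) by rw [h5]; simp]
    exact hr ξ (by linarith) (by linarith)) (by
    intro n h1 h2
    have h1' : (a:ℝ) ≤ n := by exact_mod_cast h1
    have h2' : (n:ℝ) + 2 ≤ b - 1 := by exact_mod_cast (by omega : n + 2 ≤ b - 1)
    obtain ⟨ξ, ⟨h3, h4⟩, h5⟩ := exists_hasDerivAt_eq_slope (fun x => f (x + 1) - f x)
      (fun x => -(h / π) * Real.arccos ((x+1)/μ) - -(h / π) * Real.arccos (x/μ)) (by linarith : (n:ℝ) < n + 1)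
      ((contf.comp (continuous_add_const 1)).sub contf).continuousOn (fun y hy =>
        ((fh_deriv μ h (y+1) hμ (by linarith [hy.1]) (by linarith [hy.2])).comp_add_const y 1).sub
          (fh_deriv μ h y hμ (by linarith [hy.1]) (by linarith [hy.2])))
    push_cast
    rw [show (n:ℝ) + 2 = n + 1 + 1 by ring]
    rw [show f (n + 1 + 1) - f (n + 1) - (f (n + 1) - f n) = -(h / π) * Real.arccos ((ξ+1)/μ) - -(h / π) * Real.arccos (ξ/μ) by rw [h5]; simp]
    have := arccos_gap (ξ/μ) ((ξ+1)/μ) (by have : 0 ≤ ξ/μ := div_nonneg (by linarith) hμ.le; linarith) (by gcongr; linarith) (by rw [div_le_one hμ]; linarith)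
    have k : h / π * ((ξ+1)/μ - ξ/μ) ≤ h/π * (Real.arccos (ξ/μ) - Real.arccos ((ξ+1)/μ)) := by gcongr
    have e : h / π * ((ξ+1)/μ - ξ/μ) = h / (π * μ) := by field_simp; ring
    rw [e] at k
    linarith)
  rw [← sum_Ico_split _ (by omega : a ≤ b - 1) (by omega : b - 1 ≤ b)]
  have e : Finset.Ico (b - 1) b = {b - 1} := by ext x; simp only [Finset.mem_Ico, Finset.mem_singleton]; omega
  rw [e, Finset.sum_singleton]
  have e2 : √(π * μ / h) = 1 / √(h / (π * μ)) := by
    rw [← Real.sqrt_one, ← Real.sqrt_div (by norm_num)]; congr 1; field_simp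
  rw [e2]
  exact (norm_add_le _ _).trans (add_le_add s (ee_norm _).le)

lemma E_facts (μ h E : ℝ) (hμ : 0 < μ) (hh : 0 < h) (hE : E = √(μ / h)) : √(π * μ / h) ≤ 2 * E := by
  rw [hE, show π * μ / h = π * (μ / h) by ring, Real.sqrt_mul Real.pi_pos.le]
  gcongr
  rw [Real.sqrt_le_iff]
  exact ⟨by norm_num, by linarith [Real.pi_le_four]⟩

lemma S_trivial (μ h : ℝ) (hμ : 1 ≤ μ) (h1 : 1 ≤ h) :
    ‖∑ n ∈ Finset.Ico 1 (⌊μ⌋ + 1), ee (h * (μ * gfun ((n:ℤ) / μ)))‖ ≤ 80 * √(μ * h) := by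
  have hπ := Real.pi_pos
  have fl := Int.floor_le μ
  have fl1 : 1 ≤ ⌊μ⌋ := Int.le_floor.2 (by simpa using hμ)
  rcases le_or_gt h μ with hle | hgt
  · have := SDT_phi μ h 1 (⌊μ⌋ + 1) (-(h/2)) (h/2) (by linarith) (by linarith) (by norm_num) (by push_cast; linarith) (by linarith) (by
      intro x hx1 hx2
      push_cast at hx1
      have a1 := Real.arccos_nonneg (x/μ)
      have a2 : Real.arccos (x/μ) ≤ π/2 := Real.arccos_le_pi_div_two.2 (by positivity)
      have b1 : h/π * Real.arccos (x/μ) ≤ h/π * (π/2) := by gcongr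
      have b2 : h/π * (π/2) = h/2 := by field_simp
      have b3 : 0 ≤ h/π * Real.arccos (x/μ) := by positivity
      constructor <;> linarith)
    refine this.trans ?_
    set E := √(μ/h) with hE
    have e1 := E_facts μ h E (by linarith) (by linarith) hE
    have e2 : 1 ≤ E := by
      rw [hE, Real.one_le_sqrt, one_le_div (by linarith)]; exact hle
    have e3 : √(μ * h) = h * E := by
      rw [hE, show μ * h = h^2 * (μ / h) by field_simp, Real.sqrt_mul (by positivity), Real.sqrt_sq (by linarith)]
    rw [e3]
    have : 1 ≤ h * E := by nlinarith
    calc 10 * (h/2 + 2) * (√(π * μ / h) + 1) + 1 ≤ 10 * (h/2 + 2 * h) * (2 * E + E) + h * E := by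
          gcongr; linarith
      _ ≤ _ := by nlinarith
  · refine (norm_sum_ee_le _ _).trans ?_
    rw [Int.card_Ico]
    have : ((⌊μ⌋ + 1 - 1).toNat : ℝ) = ⌊μ⌋ := by
      rw [add_sub_cancel_right]
      exact_mod_cast Int.toNat_of_nonneg (by omega)
    rw [this]
    have : μ ≤ √(μ * h) := by
      rw [Real.le_sqrt (by linarith) (by nlinarith)]; nlinarith
    linarith [Real.sqrt_nonneg (μ * h)]

lemma block_app (Z h : ℝ) (ν : ℤ) (hZ : 2 ≤ Z) (h1 : Z^51 ≤ h) (h2 : h ≤ Z^58) (hν1 : h / Z ≤ ν) (hν2 : (ν:ℝ) + 1/2 ≤ h/2) (μ : ℝ) (hμ : μ = Z^160) :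
    ‖∑ n ∈ Finset.Ico (⌊μ * Real.cos (π / h * (ν + 1/2))⌋ + 1) (⌊μ * Real.cos (π / h * (ν - 1/2))⌋ + 1), ee (h * (μ * gfun ((n:ℤ) / μ)))
      - ee (μ * h / π * Real.sin (π / h * ν)) * ((√(π * μ / h * Real.sin (π / h * ν)) : ℝ) * JJ (Z^2))‖
      ≤ 200 * √(μ / h) / Z := by
  have hπ := Real.pi_pos
  have hπ3 := Real.pi_gt_three
  have hπ4 := Real.pi_le_four
  have hZ0 : 0 < Z := by linarith
  have hZ1 : 1 ≤ Z := by linarith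
  have hh : 0 < h := lt_of_lt_of_le (by positivity) h1
  have hμ0 : 0 < μ := by rw [hμ]; positivity
  have hhZ : 0 < h / Z := by positivity
  have hν0 : 0 < ν := by exact_mod_cast (lt_of_lt_of_le hhZ hν1)
  have hν0' : (1:ℝ) ≤ ν := by exact_mod_cast hν0
  have hsin : ∀ z, π / h * (ν - 1/2) ≤ z → z ≤ π / h * (ν + 1/2) → 1 / Z ≤ Real.sin z := by
    intro z hz1 hz2
    have z0 : 0 ≤ z := le_trans (mul_nonneg (by positivity) (by linarith)) hz1
    have z1 : z ≤ π/2 := by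
      calc z ≤ π / h * (h / 2) := hz2.trans (by gcongr)
        _ = π/2 := by field_simp
    refine le_trans ?_ (Real.mul_le_sin z0 z1)
    calc 1 / Z = (h / Z) / h := by field_simp
      _ ≤ ν / h := by gcongr
      _ ≤ (2 * ν - 1) / h := by gcongr; linarith
      _ = 2 / π * (π / h * (ν - 1/2)) := by field_simp
      _ ≤ 2 / π * z := by gcongr
  set s := Real.sin (π / h * ν) with hs
  have s1 : 1 / Z ≤ s := hsin _ (by gcongr; linarith) (by gcongr; linarith)
  have s2 : s ≤ 1 := Real.sin_le_one _
  have s0 : 0 < s := lt_of_lt_of_le (by positivity) s1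
  set E := √(μ/h) with hE
  have E0 : 0 < E := Real.sqrt_pos.2 (by positivity)
  have E2 : E^2 = μ / h := Real.sq_sqrt (by positivity)
  have EZ : Z^51 ≤ E := by
    rw [hE]
    apply Real.le_sqrt_of_sq_le
    rw [le_div_iff₀ hh, hμ]
    calc (Z^51)^2 * h ≤ (Z^51)^2 * Z^58 := by gcongr
      _ = Z^160 := by ring
  have EZ6 : Z^6 ≤ E := le_trans (pow_le_pow_right₀ hZ1 (by norm_num)) EZ
  set β := h / (π * μ * s) with hβ
  have β0 : 0 < β := by positivity
  set b := √(π * μ / h * s) with hb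
  have b2 : b^2 = π * s * E^2 := by rw [hb, Real.sq_sqrt (by positivity), E2]; ring
  have bb : 1 / √β = b := by
    rw [hb, hβ, ← Real.sqrt_one, ← Real.sqrt_div (by norm_num)]; congr 1; field_simp
  have b0 : 0 < b := Real.sqrt_pos.2 (by positivity)
  have bβ : b * √β = 1 := by rw [← bb]; field_simp
  have bβ2 : β * b^2 = 1 := by
    have : √β^2 = β := Real.sq_sqrt β0.le
    rw [← this, ← mul_pow, mul_comm, bβ, one_pow]
  have bE : b ≤ 2 * E := by
    refine (abs_le_of_sq_le_sq' ?_ (by positivity)).2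
    rw [b2, mul_pow]
    have : π * s ≤ 2^2 := by nlinarith
    gcongr
  have bE' : E / Z ≤ b := by
    refine (abs_le_of_sq_le_sq' ?_ (by positivity)).2
    rw [b2, div_pow]
    have : 1 / Z^2 ≤ π * s := by
      calc 1 / Z^2 ≤ 1 / Z := by gcongr; nlinarith
        _ ≤ 1 * s := by linarith
        _ ≤ π * s := by gcongr; linarith
    calc E^2/Z^2 = 1 / Z^2 * E^2 := by ring
      _ ≤ _ := by gcongr
  have hD1 : 1 ≤ Z^2 * b := by
    calc 1 ≤ Z^7 := one_le_pow₀ hZ1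
      _ = Z^2 * (Z^6 / Z) := by field_simp
      _ ≤ Z^2 * (E / Z) := by gcongr
      _ ≤ _ := by gcongr
  have key := block_app0 μ h (1/Z) (Z^2 * b) ν hμ0 hh (by positivity) (by positivity) hν0 hν2 hsin (by
    rw [show μ * (1/Z) * (π / h / 2) = (μ / h) * (π / (2 * Z)) by ring, ← E2]
    have q : 4 * Z^3 ≤ π * E := by
      have : Z^6 = Z^3 * Z^3 := by ring
      have : 8 ≤ Z^3 := by
        calc (8:ℝ) = 2^3 := by norm_num
          _ ≤ Z^3 := by gcongr
      nlinarith
    calc Z^2 * b ≤ Z^2 * (2 * E) := by gcongr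
      _ = (4 * Z^3) * E / (2 * Z) := by field_simp; ring
      _ ≤ (π * E) * E / (2 * Z) := by gcongr
      _ = _ := by ring) β _ _ hβ rfl rfl
  rw [mul_assoc (Z^2), bβ, mul_one, bb] at key
  refine key.trans ?_
  set D := Z^2 * b with hD
  have D0 : 0 < D := by positivity
  have t1 : 4 / (h / (π * μ) * D) ≤ 16 * (E / Z) := by
    rw [show h / (π * μ) = 1 / (π * E^2) by rw [E2]; field_simp]
    calc 4 / (1 / (π * E^2) * D) = 4 * π * E^2 / (Z^2 * b) := by rw [hD]; field_simp
      _ ≤ 4 * 4 * E^2 / (Z^2 * (E / Z)) := by gcongr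
      _ = _ := by field_simp; norm_num
  have t2 : 2 * π * (h / (π * (1 / Z)^3 * μ^2) * D^3) * (2 * D + 1) ≤ 96 := by
    calc 2 * π * (h / (π * (1 / Z)^3 * μ^2) * D^3) * (2 * D + 1) ≤ 2 * π * (h / (π * (1 / Z)^3 * μ^2) * D^3) * (3 * D) := by gcongr; linarith
      _ = 6 * (h / μ^2 * Z^11 * b^4) := by rw [hD]; field_simp; norm_num
      _ ≤ 6 * (h / μ^2 * Z^11 * (2 * E)^4) := by gcongr
      _ = 96 * (h / μ^2 * Z^11 * (E^2)^2) := by ring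
      _ = 96 * (Z^11 / h) := by rw [E2]; field_simp
      _ ≤ 96 * 1 := by
        gcongr
        rw [div_le_one hh]
        exact le_trans (pow_le_pow_right₀ hZ1 (by norm_num)) h1
      _ = _ := by norm_num
  have t3 : 2 * π * β * (D + 1) * (2 * D + 1) ≤ 48 * Z^4 := by
    calc 2 * π * β * (D + 1) * (2 * D + 1) ≤ 2 * 4 * β * (D + D) * (2 * D + D) := by gcongr
      _ = 48 * Z^4 * (β * b^2) := by rw [hD]; ring
      _ = _ := by rw [bβ2, mul_one]
  have t4 : Z^4 ≤ E / Z := by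
    rw [le_div_iff₀ hZ0]
    calc Z^4 * Z = Z^5 := by ring
      _ ≤ Z^6 := pow_le_pow_right₀ hZ1 (by norm_num)
      _ ≤ E := EZ6
  have t5 : 1 ≤ Z^4 := one_le_pow₀ hZ1
  rw [mul_div_assoc]
  linarith

lemma sum_blocks (F : ℤ → ℂ) (T : ℤ → ℤ) (a : ℤ) (k : ℕ) (hT : ∀ ν, a ≤ ν → ν < a + k → T (ν+1) ≤ T ν) :
    T (a + k) ≤ T a ∧ ∑ n ∈ Finset.Ico (T (a + k)) (T a), F n = ∑ ν ∈ Finset.Ico a (a + k), ∑ n ∈ Finset.Ico (T (ν+1)) (T ν), F n := by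
  induction k with
  | zero => simp
  | succ k ih =>
    obtain ⟨i1, i2⟩ := ih (fun ν h1 h2 => hT ν h1 (by push_cast; omega))
    have h3 := hT (a + k) (by omega) (by push_cast; omega)
    have e : Finset.Ico a (a + ((k+1:ℕ):ℤ)) = insert (a + k) (Finset.Ico a (a + k)) := by
      ext x; simp only [Finset.mem_Ico, Finset.mem_insert]; push_cast; omega
    have e2 : a + ((k+1:ℕ):ℤ) = a + k + 1 := by push_cast; ring
    rw [e, Finset.sum_insert (by simp), ← i2, e2]
    exact ⟨by omega, (sum_Ico_split F h3 i1).symm⟩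

set_option maxHeartbeats 1000000 in
lemma S_main (Z h : ℝ) (hZ : 4 ≤ Z) (h1 : Z^51 ≤ h) (h2 : h ≤ Z^58) (μ : ℝ) (hμ : μ = Z^160) :
    ‖∑ n ∈ Finset.Ico 1 (⌊μ⌋ + 1), ee (h * (μ * gfun ((n:ℤ) / μ)))‖ ≤ 5000 * √(μ * h) / Z := by
  have hπ := Real.pi_pos
  have hZ0 : 0 < Z := by linarith
  have hZ1 : 1 ≤ Z := by linarith
  have hhZ2 : Z^2 ≤ h := le_trans (pow_le_pow_right₀ hZ1 (by norm_num)) h1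
  have hh : 0 < h := lt_of_lt_of_le (by positivity) h1
  have hh16 : 16 ≤ h := by nlinarith
  have hμ0 : 0 < μ := by rw [hμ]; positivity
  have hhZ : 4 ≤ h / Z := by rw [le_div_iff₀ hZ0]; nlinarith
  have hhZ' : h / Z ≤ h / 4 := by gcongr
  set E := √(μ/h) with hE
  have E0 : 0 < E := Real.sqrt_pos.2 (by positivity)
  have E1 : 1 ≤ E := by
    rw [hE, Real.one_le_sqrt, one_le_div hh, hμ]
    exact h2.trans (pow_le_pow_right₀ hZ1 (by norm_num))
  have e3 : √(μ * h) = h * E := by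
    rw [hE, show μ * h = h^2 * (μ / h) by field_simp, Real.sqrt_mul (by positivity), Real.sqrt_sq (by linarith)]
  have Ef := E_facts μ h E hμ0 hh hE
  set F : ℤ → ℂ := fun n => ee (h * (μ * gfun ((n:ℤ) / μ))) with hF
  set ν0 : ℤ := ⌈h / Z⌉ with hν0
  set ν1 : ℤ := ⌊h / 2 * (1 - 1/Z)⌋ with hν1
  have c1 : h / Z ≤ ν0 := Int.le_ceil _
  have c2 : (ν0:ℝ) < h / Z + 1 := Int.ceil_lt_add_one _
  have c3 : (ν1:ℝ) ≤ h / 2 * (1 - 1/Z) := Int.floor_le _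
  have c4 : h / 2 * (1 - 1/Z) < ν1 + 1 := Int.lt_floor_add_one _
  have c5 : h / 2 * (1 - 1/Z) = h/2 - h/Z/2 := by ring
  have c6 : ν0 ≤ ν1 := by
    have : (ν0:ℝ) ≤ ν1 := by linarith
    exact_mod_cast this
  have c7 : 0 < ν0 := by
    have : (0:ℝ) < ν0 := by linarith
    exact_mod_cast this
  set T : ℤ → ℤ := fun ν => ⌊μ * Real.cos (π / h * (ν - 1/2))⌋ + 1 with hT
  have ωh : π / h * (h / 2) = π / 2 := by field_simp
  have ang : ∀ v : ℝ, 0 ≤ v → v ≤ h/2 → 0 ≤ π / h * v ∧ π / h * v ≤ π / 2 := by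
    intro v v0 v1
    refine ⟨by positivity, ?_⟩
    rw [← ωh]; gcongr
  have Tm : ∀ ν, ν0 ≤ ν → ν < ν1 → T (ν+1) ≤ T ν := by
    intro ν g1 g2
    have g1' : (ν0:ℝ) ≤ ν := by exact_mod_cast g1
    have g2' : (ν:ℝ) + 1 ≤ ν1 := by exact_mod_cast g2
    simp only [hT]
    push_cast
    gcongr
    apply Real.cos_le_cos_of_nonneg_of_le_pi
    · exact (ang _ (by linarith) (by linarith)).1
    · linarith [(ang (ν + 1 - 1/2) (by linarith) (by linarith)).2]
    · gcongr; linarith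
  obtain ⟨k, hk⟩ := Int.eq_ofNat_of_zero_le (sub_nonneg.2 c6)
  have hk' : ν1 = ν0 + k := by omega
  obtain ⟨b1, b2⟩ := sum_blocks F T ν0 k (fun ν g1 g2 => Tm ν g1 (by omega))
  rw [← hk'] at b1 b2
  have T1 : 1 ≤ T ν1 := by
    have : 0 ≤ ⌊μ * Real.cos (π / h * (ν1 - 1/2))⌋ := by
      apply Int.floor_nonneg.2
      apply mul_nonneg hμ0.le
      have c6' : (ν0:ℝ) ≤ ν1 := by exact_mod_cast c6
      have := ang (ν1 - 1/2) (by linarith) (by linarith)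
      exact Real.cos_nonneg_of_neg_pi_div_two_le_of_le (by linarith) this.2
    simp only [hT]; omega
  have T2 : T ν0 ≤ ⌊μ⌋ + 1 := by
    simp only [hT]
    gcongr
    nlinarith [Real.cos_le_one (π / h * (ν0 - 1/2))]
  have c6' : (ν0:ℝ) ≤ ν1 := by exact_mod_cast c6
  -- main part
  set w : ℤ → ℝ := fun ν => √(π * μ / h * Real.sin (π / h * ν)) with hw
  set z : ℤ → ℂ := fun ν => ee (μ * h / π * Real.sin (π / h * ν)) with hz
  have main1 : ‖∑ ν ∈ Finset.Ico ν0 ν1, (w ν : ℂ) * z ν‖ ≤ 2 * (2 * E) * (6 * h / Z) := by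
    apply abel_int w z ν0 ν1
    · intro n _ _; exact Real.sqrt_nonneg _
    · intro n _ _
      refine le_trans ?_ Ef
      apply Real.sqrt_le_sqrt
      have : 0 ≤ π * μ / h := by positivity
      nlinarith [Real.sin_le_one (π / h * n)]
    · intro n g1 g2
      have g1' : (ν0:ℝ) ≤ n := by exact_mod_cast g1
      have g2' : (n:ℝ) + 1 ≤ ν1 := by exact_mod_cast (by omega : n + 1 ≤ ν1)
      apply Real.sqrt_le_sqrt
      gcongr ?_ * ?_
      have q1 := ang n (by linarith) (by linarith)
      have q2 := ang (n+1) (by linarith) (by linarith)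
      push_cast
      apply Real.sin_le_sin_of_le_of_le_pi_div_two (by linarith) q2.2
      gcongr; linarith
    · positivity
    · intro m hm
      have hm' : (m:ℝ) ≤ ν1 := by exact_mod_cast hm
      have := trig_sum Z h ν0 m (by linarith) h1 h2 c7.le (by linarith)
      rw [← hμ] at this
      exact this
  have main2 : ‖∑ ν ∈ Finset.Ico ν0 ν1, (∑ n ∈ Finset.Ico (T (ν+1)) (T ν), F n - z ν * ((w ν : ℝ) * JJ (Z^2)))‖ ≤ h * (200 * E / Z) := by
    refine (norm_sum_le_of_le (n := fun _ => 200 * E / Z) _ ?_).trans ?_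
    · intro ν hν
      rw [Finset.mem_Ico] at hν
      have g1' : (ν0:ℝ) ≤ ν := by exact_mod_cast hν.1
      have g2' : (ν:ℝ) + 1 ≤ ν1 := by exact_mod_cast hν.2
      have := block_app Z h ν (by linarith) h1 h2 (by linarith) (by linarith) μ hμ
      have e : (((ν + 1 : ℤ):ℝ) - 1/2) = ν + 1/2 := by push_cast; ring
      simp only [hT, e]
      exact this
    · rw [Finset.sum_const, nsmul_eq_mul, Int.card_Ico]
      gcongr
      have : ((ν1 - ν0).toNat : ℝ) = ((ν1 - ν0 : ℤ):ℝ) := by exact_mod_cast Int.toNat_of_nonneg (by omega)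
      rw [this]; push_cast; linarith
  have mainJ := JJ_bound (Z^2) (by positivity)
  have main : ‖∑ n ∈ Finset.Ico (T ν1) (T ν0), F n‖ ≤ 2 * (2 * E) * (6 * h / Z) * 170 + h * (200 * E / Z) := by
    rw [b2]
    have e : ∑ ν ∈ Finset.Ico ν0 ν1, ∑ n ∈ Finset.Ico (T (ν+1)) (T ν), F n = (∑ ν ∈ Finset.Ico ν0 ν1, (w ν : ℂ) * z ν) * JJ (Z^2)
        + ∑ ν ∈ Finset.Ico ν0 ν1, (∑ n ∈ Finset.Ico (T (ν+1)) (T ν), F n - z ν * ((w ν : ℝ) * JJ (Z^2))) := by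
      rw [Finset.sum_mul, ← Finset.sum_add_distrib]
      apply Finset.sum_congr rfl
      intro ν _; ring
    rw [e]
    refine (norm_add_le _ _).trans (add_le_add ?_ main2)
    rw [norm_mul]
    gcongr
  -- ends
  have fl := Int.floor_le μ
  have T2' : (T ν0 : ℝ) ≤ ⌊μ⌋ + 1 := by exact_mod_cast T2
  have b1' : (T ν1 : ℝ) ≤ T ν0 := by exact_mod_cast b1
  have T1' : (1:ℝ) ≤ T ν1 := by exact_mod_cast T1
  have hn : (1:ℝ) ≤ h / Z * E := by nlinarith
  have endL : ‖∑ n ∈ Finset.Ico 1 (T ν1), F n‖ ≤ 160 * (h / Z * E) := by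
    have := SDT_phi μ h 1 (T ν1) (-(h/2)) (h/2 - (ν1 - 1/2)) hμ0 hh (by norm_num) (by linarith) (by linarith) (by
      intro x hx1 hx2
      push_cast at hx1
      have a2 : Real.arccos (x/μ) ≤ π/2 := Real.arccos_le_pi_div_two.2 (by positivity)
      have b1 : h/π * Real.arccos (x/μ) ≤ h/π * (π/2) := by gcongr
      have b2 : h/π * (π/2) = h/2 := by field_simp
      have q := ang (ν1 - 1/2) (by linarith) (by linarith)
      have a3 : π / h * (ν1 - 1/2) ≤ Real.arccos (x/μ) := by
        rw [← Real.arccos_cos q.1 (by linarith)]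
        apply Real.arccos_le_arccos
        rw [div_le_iff₀ hμ0]
        have := Int.floor_le (μ * Real.cos (π / h * (ν1 - 1/2)))
        simp only [hT] at hx2
        push_cast at hx2
        linarith
      have b3 : h/π * (π / h * (ν1 - 1/2)) ≤ h/π * Real.arccos (x/μ) := by gcongr
      have b4 : h/π * (π / h * (ν1 - 1/2)) = ν1 - 1/2 := by field_simp
      constructor <;> linarith)
    refine this.trans ?_
    calc 10 * (h/2 - (ν1 - 1/2) + 2) * (√(π * μ / h) + 1) + 1 ≤ 10 * (5 * (h / Z)) * (2 * E + E) + h / Z * E := by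
          gcongr; linarith
      _ = 151 * (h / Z * E) := by ring
      _ ≤ _ := by linarith
  have endR : ‖∑ n ∈ Finset.Ico (T ν0) (⌊μ⌋ + 1), F n‖ ≤ 160 * (h / Z * E) := by
    have := SDT_phi μ h (T ν0) (⌊μ⌋ + 1) (-(ν0 - 1/2)) (ν0 - 1/2) hμ0 hh (by omega) (by push_cast; linarith) (by linarith) (by
      intro x hx1 hx2
      have b1 : 0 ≤ h/π * Real.arccos (x/μ) := by
        have := Real.arccos_nonneg (x/μ)
        positivity
      have q := ang (ν0 - 1/2) (by linarith) (by linarith)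
      have a3 : Real.arccos (x/μ) ≤ π / h * (ν0 - 1/2) := by
        rw [← Real.arccos_cos q.1 (by linarith)]
        apply Real.arccos_le_arccos
        rw [le_div_iff₀ hμ0]
        have := Int.lt_floor_add_one (μ * Real.cos (π / h * (ν0 - 1/2)))
        simp only [hT] at hx1
        push_cast at hx1
        linarith
      have b3 : h/π * Real.arccos (x/μ) ≤ h/π * (π / h * (ν0 - 1/2)) := by gcongr
      have b4 : h/π * (π / h * (ν0 - 1/2)) = ν0 - 1/2 := by field_simp
      constructor <;> linarith)
    refine this.trans ?_
    calc 10 * (ν0 - 1/2 + 2) * (√(π * μ / h) + 1) + 1 ≤ 10 * (5 * (h / Z)) * (2 * E + E) + h / Z * E := by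
          gcongr; linarith
      _ = 151 * (h / Z * E) := by ring
      _ ≤ _ := by linarith
  rw [← sum_Ico_split F T1 (b1.trans T2), ← sum_Ico_split F b1 T2]
  refine (norm_add_le _ _).trans ((add_le_add endL ((norm_add_le _ _).trans (add_le_add main endR))).trans ?_)
  rw [e3]
  have e4 : 2 * (2 * E) * (6 * h / Z) * 170 + h * (200 * E / Z) = 4280 * (h / Z * E) := by ring
  have e5 : 5000 * (h * E) / Z = 5000 * (h / Z * E) := by ring
  rw [e4, e5]
  linarith

noncomputable def QQ (x : ℝ) : ℝ := Int.fract x ^2 - Int.fract x + 1/6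

lemma QQ_hasSum (x : ℝ) : HasSum (fun n : ℕ => 1 / (n:ℝ)^2 * Real.cos (2 * π * n * x)) (π^2 * QQ x) := by
  have h := hasSum_one_div_nat_pow_mul_cos (k := 1) one_ne_zero (x := Int.fract x) ⟨Int.fract_nonneg x, (Int.fract_lt_one x).le⟩
  have e : (fun n : ℕ => 1 / (n:ℝ)^(2*1) * Real.cos (2 * π * n * Int.fract x)) = (fun n : ℕ => 1 / (n:ℝ)^2 * Real.cos (2 * π * n * x)) := by
    funext n
    congr 1
    have : 2 * π * n * x = 2 * π * n * Int.fract x + ((n * ⌊x⌋ : ℤ):ℝ) * (2 * π) := by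
      conv_lhs => rw [← Int.fract_add_floor x]
      push_cast; ring
    rw [this, Real.cos_add_int_mul_two_pi]
  rw [e] at h
  convert h using 1
  rw [show 2 * 1 = 2 by norm_num]
  have b : (Polynomial.eval (Int.fract x) (Polynomial.map (algebraMap ℚ ℝ) (Polynomial.bernoulli 2))) = Int.fract x^2 - Int.fract x + 1/6 := by
    rw [Polynomial.bernoulli]
    simp [Finset.sum_range_succ, _root_.bernoulli_one, _root_.bernoulli_zero, _root_.bernoulli_two, Polynomial.map_monomial]
    ring
  rw [b, QQ, show ((Nat.factorial 2 : ℕ):ℝ) = 2 by norm_num [Nat.factorial]]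
  ring

lemma QQ_le (x u : ℝ) : QQ (x + u) ≤ QQ x + 2 * u * (Int.fract x - 1/2) + u^2 := by
  unfold QQ
  set F := Int.fract (x + u) with hF
  set f := Int.fract x with hf
  have F0 : 0 ≤ F := Int.fract_nonneg _
  have F1 : F < 1 := Int.fract_lt_one _
  obtain ⟨m, hm⟩ : ∃ m : ℤ, f + u = F + m := by
    refine ⟨⌊x + u⌋ - ⌊x⌋, ?_⟩
    have a := Int.fract_add_floor x
    have b := Int.fract_add_floor (x + u)
    push_cast; linarith
  have key : 0 ≤ (m:ℝ) * (m - 1 + 2 * F) := by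
    rcases lt_trichotomy m 0 with h | h | h
    · have : (m:ℝ) ≤ -1 := by exact_mod_cast (by omega : m ≤ -1)
      nlinarith
    · simp [h]
    · have : (1:ℝ) ≤ m := by exact_mod_cast h
      nlinarith
  have e : u = F + m - f := by linarith
  rw [e]
  nlinarith

lemma psi_aux (s : Finset ℤ) (y : ℤ → ℝ) (u δ X : ℝ) (hu : |u| ≤ δ)
    (hX : ∀ M : ℕ, ∑ h ∈ Finset.range M, 1 / (h:ℝ)^2 * (min 2 (2 * π * h * δ) * ‖∑ n ∈ s, ee (h * y n)‖) ≤ X) :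
    |∑ n ∈ s, (QQ (y n + u) - QQ (y n))| ≤ X / π^2 := by
  have hπ := Real.pi_pos
  have hs : HasSum (fun h : ℕ => 1 / (h:ℝ)^2 * ∑ n ∈ s, (Real.cos (2 * π * h * (y n + u)) - Real.cos (2 * π * h * y n)))
      (π^2 * ∑ n ∈ s, (QQ (y n + u) - QQ (y n))) := by
    have := hasSum_sum (s := s) (fun n _ => (QQ_hasSum (y n + u)).sub (QQ_hasSum (y n)))
    have e1 : (fun h : ℕ => 1 / (h:ℝ)^2 * ∑ n ∈ s, (Real.cos (2 * π * h * (y n + u)) - Real.cos (2 * π * h * y n))) =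
        fun h : ℕ => ∑ n ∈ s, (1 / (h:ℝ)^2 * Real.cos (2 * π * h * (y n + u)) - 1 / (h:ℝ)^2 * Real.cos (2 * π * h * y n)) := by
      funext h; rw [Finset.mul_sum]
      exact Finset.sum_congr rfl fun n _ => by ring
    have e2 : π^2 * ∑ n ∈ s, (QQ (y n + u) - QQ (y n)) = ∑ n ∈ s, (π^2 * QQ (y n + u) - π^2 * QQ (y n)) := by
      rw [Finset.mul_sum]
      exact Finset.sum_congr rfl fun n _ => by ring
    rw [e1, e2]
    exact this
  have term : ∀ h : ℕ, |1 / (h:ℝ)^2 * ∑ n ∈ s, (Real.cos (2 * π * h * (y n + u)) - Real.cos (2 * π * h * y n))| ≤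
      1 / (h:ℝ)^2 * (min 2 (2 * π * h * δ) * ‖∑ n ∈ s, ee (h * y n)‖) := by
    intro h
    rw [abs_mul, abs_of_nonneg (by positivity : 0 ≤ 1 / (h:ℝ)^2)]
    gcongr
    have e : ∑ n ∈ s, (Real.cos (2 * π * h * (y n + u)) - Real.cos (2 * π * h * y n)) = ((ee (h * u) - ee 0) * ∑ n ∈ s, ee (h * y n)).re := by
      rw [Finset.mul_sum, Complex.re_sum]
      refine Finset.sum_congr rfl fun n _ => ?_
      rw [sub_mul, ← ee_add, ← ee_add, Complex.sub_re, ee_re, ee_re]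
      congr 2 <;> ring
    rw [e]
    refine (Complex.abs_re_le_norm _).trans ?_
    rw [norm_mul]
    gcongr
    apply le_min
    · refine (norm_sub_le _ _).trans ?_
      rw [ee_norm, ee_norm]; norm_num
    · refine (ee_sub_ee _ _).trans ?_
      rw [sub_zero, abs_mul, Nat.abs_cast, ← mul_assoc]
      gcongr
  have lim := hs.tendsto_sum_nat
  have : |π^2 * ∑ n ∈ s, (QQ (y n + u) - QQ (y n))| ≤ X := by
    refine le_of_tendsto' lim.abs fun M => ?_
    refine (Finset.abs_sum_le_sum_abs _ _).trans ?_
    exact (Finset.sum_le_sum fun h _ => term h).trans (hX M)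
  rw [abs_mul, abs_of_pos (by positivity)] at this
  rw [le_div_iff₀ (by positivity)]
  linarith

lemma psi_bound (s : Finset ℤ) (y : ℤ → ℝ) (δ X : ℝ) (hδ : 0 < δ)
    (hX : ∀ M : ℕ, ∑ h ∈ Finset.range M, 1 / (h:ℝ)^2 * (min 2 (2 * π * h * δ) * ‖∑ n ∈ s, ee (h * y n)‖) ≤ X) :
    |∑ n ∈ s, (Int.fract (y n) - 1/2)| ≤ s.card * δ / 2 + X / (2 * δ * π^2) := by
  have A := psi_aux s y δ δ X (by rw [abs_of_pos hδ]) hX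
  have B := psi_aux s y (-δ) δ X (by rw [abs_neg, abs_of_pos hδ]) hX
  rw [abs_le] at A B
  have i1 : ∑ n ∈ s, (QQ (y n + δ) - QQ (y n)) ≤ ∑ n ∈ s, (2 * δ * (Int.fract (y n) - 1/2) + δ^2) :=
    Finset.sum_le_sum fun n _ => by linarith [QQ_le (y n) δ]
  have i2 : ∑ n ∈ s, (QQ (y n + -δ) - QQ (y n)) ≤ ∑ n ∈ s, (-(2 * δ) * (Int.fract (y n) - 1/2) + δ^2) :=
    Finset.sum_le_sum fun n _ => by linarith [QQ_le (y n) (-δ)]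
  rw [Finset.sum_add_distrib, ← Finset.mul_sum, Finset.sum_const, nsmul_eq_mul] at i1 i2
  set P := ∑ n ∈ s, (Int.fract (y n) - 1/2)
  have e : s.card * δ / 2 + X / (2 * δ * π^2) = (s.card * δ^2 + X / π^2) / (2 * δ) := by field_simp
  rw [e, le_div_iff₀ (by positivity), ← abs_of_pos (by positivity : 0 < 2 * δ), ← abs_mul, abs_le]
  constructor <;> nlinarith [A.1, A.2, B.1, B.2]

lemma sum_sqrt_le (K : ℝ) (M : ℕ) :
    ∑ h ∈ Finset.range (M+1), (if 0 < h ∧ (h:ℝ) ≤ K then 1 / √(h:ℝ) else 0) ≤ 2 * √(min (M:ℝ) K) := by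
  induction M with
  | zero => simp
  | succ M ih =>
    rw [Finset.sum_range_succ]
    split_ifs with hc
    · have hM : (M:ℝ) ≤ K := by have := hc.2; push_cast at this; linarith
      rw [min_eq_left hM] at ih
      rw [min_eq_left hc.2]
      push_cast
      have a1 : 0 < √((M:ℝ) + 1) := Real.sqrt_pos.2 (by positivity)
      have a2 : √((M:ℝ)+1)^2 = M + 1 := Real.sq_sqrt (by positivity)
      have a3 : √(M:ℝ)^2 = M := Real.sq_sqrt (by positivity)
      have a4 := Real.sqrt_nonneg (M:ℝ)
      have : 1 / √((M:ℝ)+1) ≤ 2 * √((M:ℝ)+1) - 2 * √(M:ℝ) := by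
        rw [div_le_iff₀ a1]
        nlinarith [sq_nonneg (√((M:ℝ)+1) - √(M:ℝ))]
      linarith
    · rw [add_zero]
      refine ih.trans ?_
      gcongr
      linarith

lemma sum_pow32_le (K : ℝ) (hK : 1 ≤ K) (M : ℕ) :
    ∑ h ∈ Finset.range M, (if K < (h:ℝ) then 1 / ((h:ℝ) * √(h:ℝ)) else 0) ≤ 4 * (1 / √K - 1 / √(max (M:ℝ) K)) := by
  induction M with
  | zero => simp [max_eq_right (by linarith : (0:ℝ) ≤ K)]
  | succ M ih =>
    rw [Finset.sum_range_succ]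
    split_ifs with hc
    · rw [max_eq_left hc.le] at ih
      rw [max_eq_left (by push_cast; linarith)]
      push_cast
      have M1 : (1:ℝ) < M := by linarith
      have a1 : 0 < √(M:ℝ) := Real.sqrt_pos.2 (by linarith)
      have a2 : 0 < √((M:ℝ)+1) := Real.sqrt_pos.2 (by linarith)
      have a3 : √(M:ℝ)^2 = M := Real.sq_sqrt (by positivity)
      have a4 : √((M:ℝ)+1)^2 = M + 1 := Real.sq_sqrt (by positivity)
      set p := √(M:ℝ)
      set q := √((M:ℝ)+1)
      have pq : q ≤ 3/2 * p := by
        apply (abs_le_of_sq_le_sq' _ (by positivity)).2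
        nlinarith
      have : 1 / ((M:ℝ) * p) ≤ 4 * (1 / p - 1 / q) := by
        rw [← a3, show 4 * (1/p - 1/q) = 4 * (q - p) / (p * q) by field_simp, div_le_div_iff₀ (by positivity) (by positivity)]
        have d : (q - p) * (q + p) = 1 := by nlinarith
        have d2 : q * (q + p) ≤ 4 * p^2 := by nlinarith
        have d3 : 0 < q + p := by positivity
        have : q ≤ 4 * (q - p) * p^2 := by
          have : q * (q + p) ≤ (4 * (q - p) * p^2) * (q + p) := by
            calc q * (q+p) ≤ 4 * p^2 := d2
              _ = 4 * p^2 * ((q - p) * (q + p)) := by rw [d, mul_one]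
              _ = _ := by ring
          exact le_of_mul_le_mul_right this d3
        calc 1 * (p * q) = p * q := by ring
          _ ≤ p * (4 * (q - p) * p^2) := by gcongr
          _ = _ := by ring
      linarith
    · rw [add_zero]
      refine ih.trans ?_
      have p0 : 0 < √(max (M:ℝ) K) := Real.sqrt_pos.2 (lt_of_lt_of_le (by linarith) (le_max_right _ _))
      gcongr
      linarith

lemma term_bound (Z r N m c : ℝ) (hZ : 0 < Z) (hr : 0 < r) (hN0 : 0 ≤ N) (hm0 : 0 ≤ m) (e f : ℝ) (he : m ≤ e) (hf : N ≤ f)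
    (hc : 1 / (r^2)^2 * (e * f) ≤ c) : 1 / (r^2)^2 * (m * N) ≤ c := by
  refine le_trans ?_ hc
  have : 0 ≤ e := hm0.trans he
  gcongr

lemma psi_main (Z : ℝ) (hZ : 4 ≤ Z) (μ : ℝ) (hμ : μ = Z^160) :
    |∑ n ∈ Finset.Ico 1 (⌊μ⌋ + 1), (Int.fract (μ * gfun ((n:ℤ) / μ) + 1/4) - 1/2)| ≤ 10000 * Z^106 := by
  have hπ := Real.pi_pos
  have hπ3 := Real.pi_gt_three
  have hπ4 := Real.pi_le_four
  have hZ0 : 0 < Z := by linarith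
  have hZ1 : 1 ≤ Z := by linarith
  have hμ1 : 1 ≤ μ := by rw [hμ]; exact one_le_pow₀ hZ1
  have sq : ∀ x : ℝ, √(μ * x) = Z^80 * √x := by
    intro x
    rw [hμ, Real.sqrt_mul (by positivity), show Z^160 = (Z^80)^2 by ring, Real.sqrt_sq (by positivity)]
  have pt : ∀ h : ℕ, 1 / (h:ℝ)^2 * (min 2 (2 * π * h * (1 / Z^54)) * ‖∑ n ∈ Finset.Ico 1 (⌊μ⌋ + 1), ee (h * (μ * gfun ((n:ℤ) / μ) + 1/4))‖)
      ≤ 640 * Z^26 * (if 0 < h ∧ (h:ℝ) ≤ Z^52 then 1 / √(h:ℝ) else 0) + 40000 * Z^25 * (if 0 < h ∧ (h:ℝ) ≤ Z^54 then 1 / √(h:ℝ) else 0)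
        + 10000 * Z^79 * (if Z^54 < (h:ℝ) then 1 / ((h:ℝ) * √(h:ℝ)) else 0) + 160 * Z^80 * (if Z^58 < (h:ℝ) then 1 / ((h:ℝ) * √(h:ℝ)) else 0) := by
    intro h
    have p1 : 0 ≤ 640 * Z^26 * (if 0 < h ∧ (h:ℝ) ≤ Z^52 then 1 / √(h:ℝ) else 0) := by split_ifs <;> positivity
    have p2 : 0 ≤ 40000 * Z^25 * (if 0 < h ∧ (h:ℝ) ≤ Z^54 then 1 / √(h:ℝ) else 0) := by split_ifs <;> positivity
    have p3 : 0 ≤ 10000 * Z^79 * (if Z^54 < (h:ℝ) then 1 / ((h:ℝ) * √(h:ℝ)) else 0) := by split_ifs <;> positivity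
    have p4 : 0 ≤ 160 * Z^80 * (if Z^58 < (h:ℝ) then 1 / ((h:ℝ) * √(h:ℝ)) else 0) := by split_ifs <;> positivity
    rcases Nat.eq_zero_or_pos h with h0 | hpos
    · have : (1:ℝ) / (h:ℝ)^2 = 0 := by simp [h0]
      rw [this, zero_mul]; linarith
    have h1 : (1:ℝ) ≤ h := by exact_mod_cast hpos
    have eN : ‖∑ n ∈ Finset.Ico 1 (⌊μ⌋ + 1), ee (h * (μ * gfun ((n:ℤ) / μ) + 1/4))‖ = ‖∑ n ∈ Finset.Ico 1 (⌊μ⌋ + 1), ee (h * (μ * gfun ((n:ℤ) / μ)))‖ := by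
      have : ∀ n : ℤ, ee (h * (μ * gfun ((n:ℤ) / μ) + 1/4)) = ee (h * (μ * gfun ((n:ℤ) / μ))) * ee (h * (1/4)) := by
        intro n; rw [← ee_add]; congr 1; ring
      simp only [this]
      rw [← Finset.sum_mul, norm_mul, ee_norm, mul_one]
    rw [eN]
    set N := ‖∑ n ∈ Finset.Ico 1 (⌊μ⌋ + 1), ee (h * (μ * gfun ((n:ℤ) / μ)))‖ with hN
    have N0 : 0 ≤ N := norm_nonneg _
    have N1 : N ≤ 80 * √(μ * h) := S_trivial μ h hμ1 h1
    rw [sq] at N1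
    set r := √(h:ℝ) with hr
    have r0 : 0 < r := Real.sqrt_pos.2 (by linarith)
    have hr2 : (h:ℝ) = r^2 := (Real.sq_sqrt (by linarith)).symm
    have m0 : 0 ≤ min 2 (2 * π * h * (1 / Z^54)) := le_min (by norm_num) (by positivity)
    have m1 : min 2 (2 * π * h * (1 / Z^54)) ≤ 8 * r^2 / Z^54 := by
      refine (min_le_right _ _).trans ?_
      rw [hr2, mul_one_div]
      gcongr
      linarith
    have m2 : min 2 (2 * π * h * (1 / Z^54)) ≤ 2 := min_le_left _ _
    set m := min 2 (2 * π * h * (1 / Z^54)) with hm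
    rcases lt_or_ge (h:ℝ) (Z^51) with c1 | c1
    · have c2 : (h:ℝ) ≤ Z^52 := c1.le.trans (pow_le_pow_right₀ hZ1 (by norm_num))
      have : 1 / (h:ℝ)^2 * (m * N) ≤ 640 * Z^26 * (if 0 < h ∧ (h:ℝ) ≤ Z^52 then 1 / r else 0) := by
        rw [if_pos ⟨hpos, c2⟩, hr2]
        apply term_bound Z r N m _ hZ0 r0 N0 m0 _ _ m1 N1
        apply le_of_eq; field_simp; norm_num
      linarith
    rcases le_or_gt (h:ℝ) (Z^58) with c2 | c2
    · have N2 : N ≤ 5000 * √(μ * h) / Z := S_main Z h hZ c1 c2 μ hμ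
      rw [sq, ← hr] at N2
      rcases le_or_gt (h:ℝ) (Z^54) with c3 | c3
      · have : 1 / (h:ℝ)^2 * (m * N) ≤ 40000 * Z^25 * (if 0 < h ∧ (h:ℝ) ≤ Z^54 then 1 / r else 0) := by
          rw [if_pos ⟨hpos, c3⟩, hr2]
          apply term_bound Z r N m _ hZ0 r0 N0 m0 _ _ m1 N2
          apply le_of_eq; field_simp; norm_num
        linarith
      · have : 1 / (h:ℝ)^2 * (m * N) ≤ 10000 * Z^79 * (if Z^54 < (h:ℝ) then 1 / ((h:ℝ) * r) else 0) := by
          rw [if_pos c3, hr2]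
          apply term_bound Z r N m _ hZ0 r0 N0 m0 _ _ m2 N2
          apply le_of_eq; field_simp; norm_num
        linarith
    · have : 1 / (h:ℝ)^2 * (m * N) ≤ 160 * Z^80 * (if Z^58 < (h:ℝ) then 1 / ((h:ℝ) * r) else 0) := by
        rw [if_pos c2, hr2]
        apply term_bound Z r N m _ hZ0 r0 N0 m0 _ _ m2 N1
        apply le_of_eq; field_simp; norm_num
      linarith
  have q1 : ∀ (K : ℝ) (k : ℕ) (M : ℕ), K = Z^(2*k) → ∑ h ∈ Finset.range M, (if 0 < h ∧ (h:ℝ) ≤ K then 1 / √(h:ℝ) else 0) ≤ 2 * Z^k := by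
    intro K k M hK
    have a := sum_sqrt_le K M
    rw [Finset.sum_range_succ] at a
    have b : 0 ≤ (if 0 < M ∧ (M:ℝ) ≤ K then 1 / √(M:ℝ) else 0) := by split_ifs <;> positivity
    have c : √(min (M:ℝ) K) ≤ Z^k := by
      calc √(min (M:ℝ) K) ≤ √K := Real.sqrt_le_sqrt (min_le_right _ _)
        _ = Z^k := by rw [hK, show Z^(2*k) = (Z^k)^2 by ring, Real.sqrt_sq (by positivity)]
    linarith
  have q2 : ∀ (K : ℝ) (k : ℕ) (M : ℕ), K = Z^(2*k) → ∑ h ∈ Finset.range M, (if K < (h:ℝ) then 1 / ((h:ℝ) * √(h:ℝ)) else 0) ≤ 4 / Z^k := by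
    intro K k M hK
    have a := sum_pow32_le K (by rw [hK]; exact one_le_pow₀ hZ1) M
    have c : √K = Z^k := by rw [hK, show Z^(2*k) = (Z^k)^2 by ring, Real.sqrt_sq (by positivity)]
    rw [c] at a
    have : 0 ≤ 1 / √(max (M:ℝ) K) := by positivity
    calc _ ≤ _ := a
      _ ≤ 4 * (1 / Z^k) := by linarith
      _ = _ := by ring
  have key := psi_bound (Finset.Ico 1 (⌊μ⌋ + 1)) (fun n => μ * gfun ((n:ℤ) / μ) + 1/4) (1 / Z^54) (122560 * Z^52) (by positivity) (by
    intro M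
    refine (Finset.sum_le_sum fun h _ => pt h).trans ?_
    rw [Finset.sum_add_distrib, Finset.sum_add_distrib, Finset.sum_add_distrib, ← Finset.mul_sum, ← Finset.mul_sum, ← Finset.mul_sum, ← Finset.mul_sum]
    have a1 := q1 (Z^52) 26 M (by norm_num)
    have a2 := q1 (Z^54) 27 M (by norm_num)
    have a3 := q2 (Z^54) 27 M (by norm_num)
    have a4 := q2 (Z^58) 29 M (by norm_num)
    calc _ ≤ 640 * Z^26 * (2 * Z^26) + 40000 * Z^25 * (2 * Z^27) + 10000 * Z^79 * (4 / Z^27) + 160 * Z^80 * (4 / Z^29) := by gcongr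
      _ = 121280 * Z^52 + 640 * Z^51 := by field_simp; ring
      _ ≤ 121280 * Z^52 + 640 * Z^52 := by gcongr <;> first | exact hZ1 | norm_num
      _ ≤ _ := by nlinarith [pow_pos hZ0 52])
  refine key.trans ?_
  have card : ((Finset.Ico 1 (⌊μ⌋ + 1)).card : ℝ) ≤ Z^160 := by
    rw [Int.card_Ico, ← hμ]
    have : ((⌊μ⌋ + 1 - 1).toNat : ℝ) = ⌊μ⌋ := by
      rw [add_sub_cancel_right]
      exact_mod_cast Int.toNat_of_nonneg (Int.floor_nonneg.2 (by linarith))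
    rw [this]; exact Int.floor_le μ
  calc _ ≤ Z^160 * (1 / Z^54) / 2 + 122560 * Z^52 / (2 * (1 / Z^54) * 3^2) := by gcongr
    _ = (1/2 + 122560/18) * Z^106 := by field_simp; ring
    _ ≤ _ := by gcongr; norm_num

lemma gfun_neg (t : ℝ) : gfun (-t) = gfun t + t := by
  unfold gfun
  rw [Real.arccos_neg]
  have := Real.pi_pos.ne'
  field_simp
  ring_nf

lemma gfun_one : gfun 1 = 0 := by simp [gfun]

lemma gfun_zero : gfun 0 = 1 / π := by simp [gfun]

lemma gfun_mvt (s t : ℝ) (h0 : 0 ≤ s) (hst : s ≤ t) (h1 : t ≤ 1) :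
    -(Real.arccos s / π) * (t - s) ≤ gfun t - gfun s ∧ gfun t - gfun s ≤ -(Real.arccos t / π) * (t - s) := by
  have hπ := Real.pi_pos
  have hd : ∀ x ∈ Ioo s t, HasDerivAt gfun (-Real.arccos x / π) x := fun x hx =>
    gfun_deriv x (by linarith [hx.1]) (by linarith [hx.2])
  have hdd : DifferentiableOn ℝ gfun (interior (Icc s t)) := by
    rw [interior_Icc]
    exact fun x hx => (hd x hx).differentiableAt.differentiableWithinAt
  constructor
  · refine (convex_Icc s t).mul_sub_le_image_sub_of_le_deriv gfun_cont.continuousOn hdd ?_ s ⟨le_rfl, hst⟩ t ⟨hst, le_rfl⟩ hst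
    intro x hx
    rw [interior_Icc] at hx
    rw [(hd x hx).deriv, neg_div, neg_le_neg_iff]
    exact div_le_div_of_nonneg_right (Real.arccos_le_arccos hx.1.le) hπ.le
  · refine (convex_Icc s t).image_sub_le_mul_sub_of_deriv_le gfun_cont.continuousOn hdd ?_ s ⟨le_rfl, hst⟩ t ⟨hst, le_rfl⟩ hst
    intro x hx
    rw [interior_Icc] at hx
    rw [(hd x hx).deriv, neg_div, neg_le_neg_iff]
    exact div_le_div_of_nonneg_right (Real.arccos_le_arccos hx.2.le) hπ.le

lemma gfun_bds (t : ℝ) (h0 : 0 ≤ t) (h1 : t ≤ 1) : 0 ≤ gfun t ∧ gfun t ≤ (1 - t) / 2 := by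
  have hπ := Real.pi_pos
  obtain ⟨a, b⟩ := gfun_mvt t 1 h0 h1 le_rfl
  rw [gfun_one] at a b
  rw [Real.arccos_one] at b
  have : Real.arccos t / π ≤ 1 / 2 := by
    rw [div_le_div_iff₀ hπ (by norm_num)]
    have := Real.arccos_le_pi_div_two.2 h0
    linarith
  constructor
  · simp at b; linarith
  · nlinarith

lemma trap_step (φ D : ℝ → ℝ) (a : ℝ) (hc : Continuous φ)
    (h : ∀ s t, a ≤ s → s ≤ t → t ≤ a + 1 → D s * (t - s) ≤ φ t - φ s ∧ φ t - φ s ≤ D t * (t - s))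
    (hD : ∀ s t, a ≤ s → s ≤ t → t ≤ a + 1 → D s ≤ D t) :
    |(∫ x in a..(a+1), φ x) - (φ a + φ (a+1)) / 2| ≤ (D (a+1) - D a) / 2 := by
  have key : ∀ c : ℝ, ∫ x in a..(a+1), (φ a + c * (x - a)) = φ a + c / 2 := by
    intro c
    rw [intervalIntegral.integral_comp_sub_right (fun x => φ a + c * x)]
    rw [intervalIntegral.integral_add (by simp) (by apply Continuous.intervalIntegrable; fun_prop)]
    rw [intervalIntegral.integral_const_mul, integral_id]
    simp
    ring
  have lo : ∫ x in a..(a+1), (φ a + D a * (x - a)) ≤ ∫ x in a..(a+1), φ x := by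
    apply intervalIntegral.integral_mono_on (by linarith)
      (by apply Continuous.intervalIntegrable; fun_prop) (by apply Continuous.intervalIntegrable; fun_prop)
    intro x hx
    linarith [(h a x le_rfl hx.1 hx.2).1]
  have hi : ∫ x in a..(a+1), φ x ≤ ∫ x in a..(a+1), (φ a + D (a+1) * (x - a)) := by
    apply intervalIntegral.integral_mono_on (by linarith)
      (by apply Continuous.intervalIntegrable; fun_prop) (by apply Continuous.intervalIntegrable; fun_prop)
    intro x hx
    have h1 := (h a x le_rfl hx.1 hx.2).2
    have h2 := hD x (a+1) hx.1 hx.2 le_rfl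
    nlinarith [hx.1]
  rw [key] at lo hi
  obtain ⟨e1, e2⟩ := h a (a+1) le_rfl (by linarith) le_rfl
  rw [abs_le]
  constructor <;> linarith

lemma trap (φ D : ℝ → ℝ) (hc : Continuous φ) (M : ℕ)
    (h : ∀ s t : ℝ, 0 ≤ s → s ≤ t → t ≤ M → D s * (t - s) ≤ φ t - φ s ∧ φ t - φ s ≤ D t * (t - s))
    (hD : ∀ s t : ℝ, 0 ≤ s → s ≤ t → t ≤ M → D s ≤ D t) :
    |(∫ x in (0:ℝ)..M, φ x) - ∑ n ∈ Finset.Ico (1:ℤ) (M + 1), φ n - (φ 0 - φ M) / 2| ≤ (D M - D 0) / 2 := by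
  induction M with
  | zero => simp
  | succ k ih =>
    push_cast at h hD ⊢
    have ih := ih (fun s t h0 h1 h2 => h s t h0 h1 (by linarith)) (fun s t h0 h1 h2 => hD s t h0 h1 (by linarith))
    have hk : (0:ℝ) ≤ k := by positivity
    have st := trap_step φ D k hc (fun s t h0 h1 h2 => h s t (by linarith) h1 h2) (fun s t h0 h1 h2 => hD s t (by linarith) h1 h2)
    rw [← intervalIntegral.integral_add_adjacent_intervals (b := (k:ℝ)) (hc.intervalIntegrable _ _) (hc.intervalIntegrable _ _)]
    have : Finset.Ico (1:ℤ) (k + 1 + 1) = insert (k+1 : ℤ) (Finset.Ico (1:ℤ) (k+1)) := by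
      ext x; simp only [Finset.mem_Ico, Finset.mem_insert]; omega
    rw [this, Finset.sum_insert (by simp)]
    push_cast
    rw [abs_le] at *
    constructor <;> linarith [ih.1, ih.2, st.1, st.2]

lemma sum_even (F : ℤ → ℝ) (M : ℕ) :
    ∑ n ∈ Finset.Icc (-(M:ℤ)) M, F |n| = F 0 + 2 * ∑ n ∈ Finset.Ico (1:ℤ) (M + 1), F n := by
  induction M with
  | zero => simp
  | succ k ih =>
    push_cast
    have h1 : Finset.Ico (1:ℤ) (k + 1 + 1) = insert (k+1 : ℤ) (Finset.Ico (1:ℤ) (k+1)) := by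
      ext x; simp only [Finset.mem_Ico, Finset.mem_insert]; omega
    have h2 : Finset.Icc (-(k + 1 : ℤ)) (k + 1) = insert (k+1 : ℤ) (insert (-(k+1:ℤ)) (Finset.Icc (-(k:ℤ)) k)) := by
      ext x; simp only [Finset.mem_Icc, Finset.mem_insert]; omega
    rw [h1, h2, Finset.sum_insert (by simp only [Finset.mem_insert, Finset.mem_Icc]; omega),
      Finset.sum_insert (by simp only [Finset.mem_Icc]; omega), Finset.sum_insert (by simp), ih, abs_neg,
      abs_of_nonneg (by positivity : (0:ℤ) ≤ k + 1)]
    ring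

lemma vol_Omega : (volume OmegaSet).toReal = 2 * ∫ t in (0:ℝ)..1, gfun t := by
  have hm : MeasurableSet OmegaSet := by
    have := gfun_cont
    apply IsClosed.measurableSet
    unfold OmegaSet
    apply IsClosed.and (isClosed_le (by fun_prop) (by fun_prop))
    apply IsClosed.and (isClosed_le (by fun_prop) (by fun_prop))
    apply IsClosed.and (isClosed_le (by fun_prop) (by fun_prop))
    exact isClosed_le (by fun_prop) (by fun_prop)
  have hcont := gfun_cont
  have hc : Continuous (fun t => gfun t - max 0 (-t)) := by fun_prop
  have hnn : ∀ t ∈ Icc (-1:ℝ) 1, 0 ≤ gfun t - max 0 (-t) := by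
    intro t ht
    rcases le_total 0 t with h | h
    · rw [max_eq_left (by linarith)]
      linarith [(gfun_bds t h ht.2).1]
    · rw [max_eq_right (by linarith)]
      have := gfun_neg (-t)
      rw [neg_neg] at this
      linarith [(gfun_bds (-t) (by linarith) (by linarith [ht.1])).1]
  have e1 : volume OmegaSet = ∫⁻ t in Icc (-1:ℝ) 1, ENNReal.ofReal (gfun t - max 0 (-t)) := by
    rw [Measure.volume_eq_prod, Measure.prod_apply hm, ← lintegral_indicator measurableSet_Icc]
    congr 1
    ext t
    by_cases ht : t ∈ Icc (-1:ℝ) 1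
    · rw [indicator_of_mem ht, ← Real.volume_Icc]
      congr 1
      ext s
      simp [OmegaSet, ht.1, ht.2]
    · rw [indicator_of_notMem ht]
      have : Prod.mk t ⁻¹' OmegaSet = ∅ := by
        ext s
        simp only [OmegaSet, mem_preimage, mem_ofPred_eq, mem_empty_iff_false, iff_false]
        rintro ⟨a, b, -⟩
        exact ht ⟨a, b⟩
      rw [this]; simp
  rw [e1, ← ofReal_integral_eq_lintegral_ofReal hc.integrableOn_Icc
    ((ae_restrict_iff' measurableSet_Icc).2 (Filter.Eventually.of_forall hnn)),
    ENNReal.toReal_ofReal (setIntegral_nonneg measurableSet_Icc hnn),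
    integral_Icc_eq_integral_Ioc, ← intervalIntegral.integral_of_le (by norm_num),
    ← intervalIntegral.integral_add_adjacent_intervals (b := (0:ℝ)) (hc.intervalIntegrable _ _) (hc.intervalIntegrable _ _)]
  have a1 : ∫ t in (0:ℝ)..1, (gfun t - max 0 (-t)) = ∫ t in (0:ℝ)..1, gfun t := by
    apply intervalIntegral.integral_congr
    intro t ht
    rw [uIcc_of_le (by norm_num)] at ht
    simp [max_eq_left (by linarith [ht.1] : -t ≤ 0)]
  have a2 : ∫ t in (-1:ℝ)..0, (gfun t - max 0 (-t)) = ∫ t in (-1:ℝ)..0, gfun (-t) := by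
    apply intervalIntegral.integral_congr
    intro t ht
    rw [uIcc_of_le (by norm_num)] at ht
    simp only [gfun_neg, max_eq_right (by linarith [ht.2] : 0 ≤ -t)]
    ring
  rw [a1, a2, intervalIntegral.integral_comp_neg]
  simp
  ring

lemma NOmega_eq (μ : ℝ) (hμ : 0 < μ) : (NOmega μ : ℝ) =
    ∑ n ∈ Finset.Icc (-⌊μ⌋) ⌊μ⌋, (⌊μ * gfun ((|n| : ℤ) / μ) + 1/4⌋ : ℝ) := by
  have sh : ∀ n : ℤ, μ * gfun (n / μ) = μ * gfun ((|n| : ℤ) / μ) + max 0 (-(n:ℝ)) := by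
    intro n
    rcases le_total 0 n with h | h
    · have : (0:ℝ) ≤ n := by exact_mod_cast h
      rw [abs_of_nonneg h, max_eq_left (by linarith)]; ring
    · have : (n:ℝ) ≤ 0 := by exact_mod_cast h
      rw [abs_of_nonpos h, max_eq_right (by linarith)]
      push_cast
      rw [neg_div, gfun_neg]
      field_simp
      ring
  have nn : ∀ n ∈ Finset.Icc (-⌊μ⌋) ⌊μ⌋, 0 ≤ ⌊μ * gfun ((|n| : ℤ) / μ) + 1/4⌋ := by
    intro n hn
    rw [Finset.mem_Icc] at hn
    have h1 : |n| ≤ ⌊μ⌋ := abs_le.2 hn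
    have h2 : ((|n| : ℤ) : ℝ) ≤ μ := (Int.cast_le.2 h1).trans (Int.floor_le μ)
    have h3 : (0:ℝ) ≤ ((|n| : ℤ) : ℝ) := by exact_mod_cast abs_nonneg n
    have := (gfun_bds (((|n| : ℤ):ℝ) / μ) (by positivity) (by rw [div_le_one hμ]; exact h2)).1
    apply Int.floor_nonneg.2
    positivity
  set T : Finset (Σ _ : ℤ, ℤ) := (Finset.Icc (-⌊μ⌋) ⌊μ⌋).sigma (fun n => Finset.Icc 1 ⌊μ * gfun ((|n| : ℤ) / μ) + 1/4⌋) with hT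
  set e : (Σ _ : ℤ, ℤ) → ℤ × ℤ := fun q => (q.1, q.2 + max 0 (-q.1)) with he
  have inj : Function.Injective e := by
    rintro ⟨a, b⟩ ⟨c, d⟩ h
    simp only [he, Prod.mk.injEq] at h
    obtain ⟨rfl, h⟩ := h
    simp at h
    rw [h]
  have hS : {p : ℤ × ℤ | (((p.1 : ℝ)), ((p.2 : ℝ) - 1/4)) ∈ μ • OmegaSet} = e '' (T : Set (Σ _ : ℤ, ℤ)) := by
    ext ⟨n, m⟩
    have lhs : (((n : ℝ)), ((m : ℝ) - 1/4)) ∈ μ • OmegaSet ↔ (-μ ≤ n ∧ (n:ℝ) ≤ μ ∧ max 0 (-(n:ℝ)) ≤ m - 1/4 ∧ (m:ℝ) - 1/4 ≤ μ * gfun (n / μ)) := by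
      rw [mem_smul_set_iff_inv_smul_mem₀ hμ.ne']
      simp only [OmegaSet, mem_ofPred_eq, Prod.smul_mk, smul_eq_mul, inv_mul_eq_div]
      rw [le_div_iff₀ hμ, div_le_one hμ, div_le_iff₀ hμ, le_div_iff₀ hμ, max_mul_of_nonneg _ _ hμ.le, mul_comm μ,
        ← neg_div, div_mul_cancel₀ _ hμ.ne']
      simp
    rw [mem_ofPred_eq, lhs, sh]
    have rhs : (n, m) ∈ e '' (T : Set (Σ _ : ℤ, ℤ)) ↔ (⟨n, m - max 0 (-n)⟩ : Σ _ : ℤ, ℤ) ∈ T := by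
      constructor
      · rintro ⟨⟨a, b⟩, h, h2⟩
        simp only [he, Prod.mk.injEq] at h2
        obtain ⟨rfl, rfl⟩ := h2
        simpa using h
      · intro h
        exact ⟨_, h, by simp [he]⟩
    rw [rhs, hT, Finset.mem_sigma, Finset.mem_Icc, Finset.mem_Icc, Int.le_floor, Int.le_floor]
    have h3 : -⌊μ⌋ ≤ n ↔ -μ ≤ n := by
      rw [neg_le, Int.le_floor, neg_le]
      push_cast
      rfl
    set k : ℤ := m - max 0 (-n) with hk
    have hkr : (k:ℝ) = m - max 0 (-(n:ℝ)) := by rw [hk]; push_cast; rfl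
    have h1 : (1 ≤ k) ↔ max 0 (-(n:ℝ)) ≤ m - 1/4 := by
      constructor
      · intro h
        have : (1:ℝ) ≤ k := by exact_mod_cast h
        linarith
      · intro h
        have : (0:ℝ) < k := by linarith
        have : 0 < k := by exact_mod_cast this
        omega
    have h2 : (k:ℝ) ≤ μ * gfun ((|n| : ℤ) / μ) + 1/4 ↔ (m:ℝ) - 1/4 ≤ μ * gfun ((|n| : ℤ) / μ) + max 0 (-(n:ℝ)) := by
      rw [hkr]; constructor <;> intro h <;> linarith
    rw [← h1, ← h2, ← h3]
    tauto
  unfold NOmega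
  rw [hS, ncard_image_of_injective _ inj, ncard_coe_finset, hT, Finset.card_sigma, Nat.cast_sum]
  apply Finset.sum_congr rfl
  intro n hn
  have := nn n hn
  rw [Int.card_Icc]
  rw [show ⌊μ * gfun ((|n| : ℤ) / μ) + 1/4⌋ + 1 - 1 = ⌊μ * gfun ((|n| : ℤ) / μ) + 1/4⌋ by ring]
  have e := Int.toNat_of_nonneg this
  exact_mod_cast congrArg (Int.cast : ℤ → ℝ) e

lemma count_main (μ : ℝ) (hμ : 1 < μ) :
    |(NOmega μ : ℝ) - (volume OmegaSet).toReal * μ^2 + μ/2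
      + 2 * ∑ n ∈ Finset.Ico 1 (⌊μ⌋ + 1), (Int.fract (μ * gfun ((n:ℤ) / μ) + 1/4) - 1/2)| ≤ 5 := by
  have hμ0 : 0 < μ := by linarith
  have hπ := Real.pi_pos
  obtain ⟨M, hM⟩ : ∃ M : ℕ, ⌊μ⌋ = M := Int.eq_ofNat_of_zero_le (Int.floor_nonneg.2 hμ0.le)
  have hM1 : (M:ℝ) ≤ μ := by have := Int.floor_le μ; rw [hM] at this; exact_mod_cast this
  have hM2 : μ < M + 1 := by have := Int.lt_floor_add_one μ; rw [hM] at this; exact_mod_cast this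
  have hM0 : (0:ℝ) ≤ M := by positivity
  have hcont := gfun_cont
  set φ : ℝ → ℝ := fun x => μ * gfun (x / μ) with hφ
  have hc : Continuous φ := by rw [hφ]; fun_prop
  set D : ℝ → ℝ := fun x => -(Real.arccos (x / μ) / π) with hD
  have bd : ∀ x, 0 ≤ x → x ≤ μ → 0 ≤ φ x ∧ φ x ≤ (μ - x) / 2 := by
    intro x h0 h1
    obtain ⟨a, b⟩ := gfun_bds (x/μ) (by positivity) ((div_le_one hμ0).2 h1)
    refine ⟨by simp only [hφ]; positivity, ?_⟩
    calc φ x ≤ μ * ((1 - x/μ)/2) := mul_le_mul_of_nonneg_left b hμ0.le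
      _ = _ := by field_simp
  have tr := trap φ D hc M (by
    intro s t h0 h1 h2
    obtain ⟨a, b⟩ := gfun_mvt (s/μ) (t/μ) (by positivity) (by gcongr) ((div_le_one hμ0).2 (by linarith))
    have e : ∀ c : ℝ, c * (t - s) = μ * (c * (t/μ - s/μ)) := by intro c; field_simp
    simp only [hφ, hD]
    rw [e, e, ← mul_sub]
    exact ⟨mul_le_mul_of_nonneg_left a hμ0.le, mul_le_mul_of_nonneg_left b hμ0.le⟩) (by
    intro s t h0 h1 h2
    simp only [hD, neg_le_neg_iff]
    exact div_le_div_of_nonneg_right (Real.arccos_le_arccos (by gcongr)) hπ.le)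
  have hDM : D M ≤ 0 := by
    simp only [hD, neg_nonpos]
    have := Real.arccos_nonneg (M/μ)
    positivity
  have hD0 : D 0 = -(1/2) := by
    simp only [hD, zero_div, Real.arccos_zero]
    field_simp
  have hI : ∫ x in (0:ℝ)..μ, φ x = μ^2 * ∫ t in (0:ℝ)..1, gfun t := by
    simp only [hφ]
    rw [intervalIntegral.integral_const_mul, intervalIntegral.integral_comp_div _ hμ0.ne', zero_div, div_self hμ0.ne']
    simp only [smul_eq_mul]
    ring
  have hsp := intervalIntegral.integral_add_adjacent_intervals (hc.intervalIntegrable (0:ℝ) (M:ℝ)) (hc.intervalIntegrable (M:ℝ) μ) (μ := volume)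
  have r1 : 0 ≤ ∫ x in (M:ℝ)..μ, φ x :=
    intervalIntegral.integral_nonneg hM1 (fun x hx => (bd x (by linarith [hx.1]) hx.2).1)
  have r2 : ∫ x in (M:ℝ)..μ, φ x ≤ 1 := by
    calc ∫ x in (M:ℝ)..μ, φ x ≤ ∫ x in (M:ℝ)..μ, (1:ℝ) := by
          apply intervalIntegral.integral_mono_on hM1 (hc.intervalIntegrable _ _) (by simp)
          intro x hx
          linarith [(bd x (by linarith [hx.1]) hx.2).2, hx.1]
      _ ≤ 1 := by simp; linarith
  have fl : ∀ n : ℤ, (⌊μ * gfun ((n:ℤ) / μ) + 1/4⌋ : ℝ) = φ n - 1/4 - (Int.fract (μ * gfun ((n:ℤ) / μ) + 1/4) - 1/2) - 1/2 + 1/2 - 1/2 + 1/2 := by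
    intro n
    have := Int.floor_add_fract (μ * gfun ((n:ℤ) / μ) + 1/4)
    simp only [hφ]
    linarith
  have hN := NOmega_eq μ hμ0
  rw [hM] at hN ⊢
  rw [sum_even (fun n => (⌊μ * gfun ((n:ℤ) / μ) + 1/4⌋ : ℝ))] at hN
  have hs : ∑ n ∈ Finset.Ico (1:ℤ) (M + 1), (⌊μ * gfun ((n:ℤ) / μ) + 1/4⌋ : ℝ)
      = ∑ n ∈ Finset.Ico (1:ℤ) (M + 1), φ n - M / 4
        - ∑ n ∈ Finset.Ico (1:ℤ) (M + 1), (Int.fract (μ * gfun ((n:ℤ) / μ) + 1/4) - 1/2) := by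
    rw [Finset.sum_congr rfl (fun n _ => (fl n).trans
      (by ring : _ = φ n - 1/4 - (Int.fract (μ * gfun ((n:ℤ) / μ) + 1/4) - 1/2))), Finset.sum_sub_distrib, Finset.sum_sub_distrib]
    congr 2
    simp
    ring
  rw [hs] at hN
  have f0 : (⌊μ * gfun (((0:ℤ):ℝ) / μ) + 1/4⌋ : ℝ) ≤ φ 0 + 1/4 ∧ φ 0 + 1/4 - 1 ≤ (⌊μ * gfun (((0:ℤ):ℝ) / μ) + 1/4⌋ : ℝ) := by
    have h1 := Int.floor_le (μ * gfun (((0:ℤ):ℝ) / μ) + 1/4)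
    have h2 := Int.lt_floor_add_one (μ * gfun (((0:ℤ):ℝ) / μ) + 1/4)
    simp only [hφ]
    push_cast at *
    constructor <;> linarith
  rw [vol_Omega]
  obtain ⟨b1, b2⟩ := bd M hM0 hM1
  rw [abs_le] at tr ⊢
  obtain ⟨t1, t2⟩ := tr
  obtain ⟨f1, f2⟩ := f0
  constructor <;> nlinarith

theorem lattice_remainder_1 :
    ∃ C : ℝ, 0 < C ∧ ∀ μ : ℝ, 1 < μ →
      |(NOmega μ : ℝ) - (MeasureTheory.volume OmegaSet).toReal * μ^2 + μ/2| ≤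
        C * μ ^ ((2:ℝ)/3 - 1/495) := by
  refine ⟨2 * (4:ℝ)^160 + 20005, by positivity, ?_⟩
  intro μ hμ
  have hμ0 : 0 < μ := by linarith
  have cm := count_main μ hμ
  set S := ∑ n ∈ Finset.Ico 1 (⌊μ⌋ + 1), (Int.fract (μ * gfun ((n:ℤ) / μ) + 1/4) - 1/2) with hS
  have hP : 1 ≤ μ ^ ((2:ℝ)/3 - 1/495) := Real.one_le_rpow hμ.le (by norm_num)
  set P := μ ^ ((2:ℝ)/3 - 1/495) with hPd
  have hSb : 2 * |S| ≤ (2 * (4:ℝ)^160 + 20000) * P := by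
    set Z := μ ^ ((1:ℝ)/160) with hZ
    have hZ0 : 0 < Z := Real.rpow_pos_of_pos hμ0 _
    have hZμ : μ = Z^160 := by
      rw [hZ, ← Real.rpow_natCast, ← Real.rpow_mul hμ0.le]; norm_num
    rcases le_or_gt 4 Z with h4 | h4
    · have h := psi_main Z h4 μ hZμ
      rw [← hS] at h
      have hZP : Z^106 ≤ P := by
        rw [hZ, ← Real.rpow_natCast, ← Real.rpow_mul hμ0.le, hPd]
        exact Real.rpow_le_rpow_of_exponent_le hμ.le (by norm_num)
      have : (0:ℝ) ≤ 2 * (4:ℝ)^160 * P := by positivity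
      nlinarith
    · have hμ4 : μ ≤ (4:ℝ)^160 := by
        rw [hZμ]; gcongr
      have tS : |S| ≤ μ := by
        calc |S| ≤ ∑ n ∈ Finset.Ico 1 (⌊μ⌋ + 1), |Int.fract (μ * gfun ((n:ℤ) / μ) + 1/4) - 1/2| := Finset.abs_sum_le_sum_abs _ _
          _ ≤ ∑ n ∈ Finset.Ico 1 (⌊μ⌋ + 1), (1:ℝ) := by
            apply Finset.sum_le_sum
            intro n _
            have h1 := Int.fract_nonneg (μ * gfun ((n:ℤ) / μ) + 1/4)
            have h2 := (Int.fract_lt_one (μ * gfun ((n:ℤ) / μ) + 1/4)).le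
            rw [abs_le]; constructor <;> linarith
          _ = (⌊μ⌋ : ℝ) := by
            have := Int.toNat_of_nonneg (Int.floor_nonneg.2 hμ0.le)
            simp only [Finset.sum_const, Int.card_Ico, nsmul_eq_mul, mul_one, add_sub_cancel_right]
            exact_mod_cast congrArg (Int.cast : ℤ → ℝ) this
          _ ≤ μ := Int.floor_le μ
      have h1 : (4:ℝ)^160 * 1 ≤ (4:ℝ)^160 * P := by gcongr
      generalize (4:ℝ)^160 = A at *
      nlinarith
  have : |(NOmega μ : ℝ) - (volume OmegaSet).toReal * μ^2 + μ/2| ≤ 5 + 2 * |S| := by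
    generalize (NOmega μ : ℝ) - (volume OmegaSet).toReal * μ^2 + μ/2 = Q at *
    rw [abs_le] at cm ⊢
    constructor <;> linarith [neg_abs_le S, le_abs_self S]
  generalize (4:ℝ)^160 = A at *
  linarith
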